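/- arXiv:2310.10552 — 6 statements merged into one kernel-verified Lean document; each statement's English description precedes it below -/
import Mathlib

section
/- There exists a constant C ≥ 0 such that for every h ∈ (0, 1/λ) and every bounded continuous function v_h : ℝⁿ → ℝ satisfying the semidiscrete dynamic programming equation v_h(y) = min_{u ∈ U_ad} { (1 − λh) v_h(y + h f(y,u)) + h g(y,u) } for all y ∈ ℝⁿ, one has sup_{y ∈ ℝⁿ} |v(y) − v_h(y)| ≤ C h. -/
open MeasureTheory Real Set

/-- **Shapley–Folkman**: a sum of points of convex hulls of finite sets in a space of dimension
`d` can be rewritten so that all but `d` of the summands lie in the sets themselves. -/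
theorem exists_sum_eq_card_le_finrank {ι F : Type*} [NormedAddCommGroup F]
    [NormedSpace ℝ F] [FiniteDimensional ℝ F] (A : ι → Set F) (hA : ∀ i, (A i).Finite)
    (p : ι → F) (hp : ∀ i, p i ∈ convexHull ℝ (A i)) (s : Finset ι) :
    ∃ x : ι → F, (∀ i, x i ∈ convexHull ℝ (A i)) ∧ ∑ i ∈ s, x i = ∑ i ∈ s, p i ∧
      ∃ T ⊆ s, T.card ≤ Module.finrank ℝ F ∧ ∀ i ∈ s, i ∉ T → x i ∈ A i := by
  classical
  let K : Set (ι → F) :=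
    univ.pi (fun i ↦ convexHull ℝ (A i)) ∩ {x | ∑ i ∈ s, x i = ∑ i ∈ s, p i}
  have hK : IsCompact K := by
    refine (isCompact_univ_pi fun i ↦ (hA i).isCompact_convexHull ℝ).inter_right ?_
    exact isClosed_eq (continuous_finsetSum _ fun i _ ↦ continuous_apply i) continuous_const
  obtain ⟨x, hxK, hx⟩ := hK.extremePoints_nonempty ⟨p, fun i _ ↦ hp i, rfl⟩
  have hxc : ∀ i, x i ∈ convexHull ℝ (A i) := fun i ↦ hxK.1 i (mem_univ i)
  refine ⟨x, hxc, hxK.2, s.filter (fun i ↦ x i ∉ A i), Finset.filter_subset _ _, ?_, ?_⟩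
  swap
  · intro i hi hi'
    by_contra h
    exact hi' (Finset.mem_filter.2 ⟨hi, h⟩)
  set T := s.filter (fun i ↦ x i ∉ A i)
  have hdir : ∀ i, ∃ d : F, i ∈ T → d ≠ 0 ∧
      ∀ c : ℝ, |c| ≤ 1 → x i + c • d ∈ convexHull ℝ (A i) := by
    intro i
    by_cases hi : i ∈ T
    swap
    · exact ⟨0, fun h ↦ absurd h hi⟩
    have hne : x i ∉ (convexHull ℝ (A i)).extremePoints ℝ := fun h ↦
      (Finset.mem_filter.1 hi).2 (extremePoints_convexHull_subset h)
    have : ∃ y ∈ convexHull ℝ (A i), ∃ z ∈ convexHull ℝ (A i),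
        x i ∈ openSegment ℝ y z ∧ y ≠ x i := by
      by_contra! h
      exact hne (mem_extremePoints_iff_left.2 ⟨hxc i, fun y hy z hz ↦ h y hy z hz⟩)
    obtain ⟨y, hy, z, hz, ⟨a, b, ha, hb, hab, hx'⟩, hne'⟩ := this
    have hyz : y - z ≠ 0 := by
      intro h
      rw [sub_eq_zero] at h
      subst h
      exact hne' (by rw [← hx', ← add_smul, hab, one_smul])
    refine ⟨(min a b) • (y - z), fun _ ↦ ⟨smul_ne_zero (lt_min ha hb).ne' hyz, fun c hc ↦ ?_⟩⟩
    have hm : |c * min a b| ≤ min a b := by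
      rw [abs_mul, abs_of_pos (lt_min ha hb)]
      exact mul_le_of_le_one_left (lt_min ha hb).le hc
    rw [abs_le] at hm
    have e : x i + c • min a b • (y - z) =
        (a + c * min a b) • y + (b - c * min a b) • z := by
      rw [← hx']; module
    rw [e]
    exact convex_convexHull ℝ (A i) hy hz (by linarith [min_le_left a b])
      (by linarith [min_le_right a b]) (by linarith)
  choose d hd using hdir
  have hli : LinearIndepOn ℝ d (T : Set ι) := by
    rw [linearIndepOn_finset_iff]
    by_contra! h
    obtain ⟨c, hc, i, hi, hci⟩ := h
    set m : ℝ := ∑ j ∈ T, |c j| with hm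
    have hle : ∀ j ∈ T, |c j| ≤ m := fun j hj ↦
      Finset.single_le_sum (f := fun j ↦ |c j|) (fun _ _ ↦ abs_nonneg _) hj
    have hmpos : 0 < m := (abs_pos.2 hci).trans_le (hle i hi)
    have hmem : ∀ ε : ℝ, |ε| = 1 →
        (fun j ↦ if j ∈ T then x j + (ε * c j / m) • d j else x j) ∈ K := by
      intro ε hε
      refine ⟨fun j _ ↦ ?_, ?_⟩
      · by_cases hj : j ∈ T
        · simp only [hj, if_true]
          refine (hd j hj).2 _ ?_
          rw [abs_div, abs_mul, hε, one_mul, abs_of_pos hmpos]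
          exact (div_le_one hmpos).2 (hle j hj)
        · simp only [hj, if_false]
          exact hxc j
      · have h1 : ∀ j, (if j ∈ T then x j + (ε * c j / m) • d j else x j) =
            x j + if j ∈ T then (ε / m) • c j • d j else 0 := by
          intro j
          split_ifs
          · rw [smul_smul]; congr 2; ring
          · simp
        have h2 : ∑ j ∈ s, (if j ∈ T then (ε / m) • c j • d j else 0) = 0 := by
          rw [← Finset.sum_filter]
          have : s.filter (fun j ↦ j ∈ T) = T := by
            ext j; simp only [Finset.mem_filter, T]; tauto
          rw [this, ← Finset.smul_sum, hc, smul_zero]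
        change ∑ j ∈ s, (if j ∈ T then x j + (ε * c j / m) • d j else x j) = _
        rw [Finset.sum_congr rfl fun j _ ↦ h1 j, Finset.sum_add_distrib, h2, add_zero]
        exact hxK.2
    have := hx (hmem 1 (by simp)) (hmem (-1) (by simp)) ⟨1 / 2, 1 / 2, by norm_num, by norm_num,
      by norm_num, by
        ext j
        by_cases hj : j ∈ T
        · simp only [Pi.add_apply, Pi.smul_apply, hj, if_true]
          module
        · simp only [Pi.add_apply, Pi.smul_apply, hj, if_false]
          module⟩
    have := congrFun this i
    simp only [hi, if_true, add_eq_left, smul_eq_zero, one_mul, div_eq_zero_iff] at this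
    rcases this with (h | h) | h
    · exact hci h
    · exact hmpos.ne' h
    · exact (hd i hi).1 h
  simpa using LinearIndependent.fintype_card_le_finrank hli

/-- The induction behind the Bárány–Grinberg theorem: after `k` steps all but `d` of the chosen
points lie in the sets themselves, and every earlier partial sum is preserved up to `d` summands. -/
theorem exists_fractional_selection {F : Type*} [NormedAddCommGroup F]
    [NormedSpace ℝ F] [FiniteDimensional ℝ F] (A : ℕ → Set F) (hA : ∀ i, (A i).Finite)
    (w : ℕ → F) (hw : ∀ i, w i ∈ convexHull ℝ (A i)) (k : ℕ) :
    ∃ (a : ℕ → F) (S : Finset ℕ), (∀ j, a j ∈ convexHull ℝ (A j)) ∧ S ⊆ Finset.range k ∧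
      S.card ≤ Module.finrank ℝ F ∧ (∀ j < k, j ∉ S → a j ∈ A j) ∧ (∀ j, k ≤ j → a j = w j) ∧
      ∑ j ∈ Finset.range k, a j = ∑ j ∈ Finset.range k, w j ∧
      ∀ i ≤ k, ∃ (p : ℕ → F) (T : Finset ℕ), (∀ j, p j ∈ convexHull ℝ (A j)) ∧
        T.card ≤ Module.finrank ℝ F ∧ (∀ j < i, j ∉ T → p j = a j) ∧ (∀ j < i, j ∈ S → j ∈ T) ∧
        ∑ j ∈ Finset.range i, p j = ∑ j ∈ Finset.range i, w j := by
  classical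
  induction k with
  | zero =>
    refine ⟨w, ∅, hw, by simp, by simp, by simp, by simp, by simp, fun i hi ↦ ⟨w, ∅, hw, ?_⟩⟩
    simp
  | succ k ih =>
    obtain ⟨a, S, haA, hSk, -, haS, haw, hsum, hpre⟩ := ih
    have hA' : ∀ i, (if i ∈ insert k S then A i else {a i}).Finite := by
      intro i; split_ifs
      exacts [hA i, finite_singleton _]
    obtain ⟨x, hx, hxs, T, hT, hTc, hxT⟩ := exists_sum_eq_card_le_finrank
      (fun i ↦ if i ∈ insert k S then A i else {a i}) hA' a
      (fun i ↦ by
        by_cases h : i ∈ insert k S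
        · simpa only [h, if_true] using haA i
        · simp only [h, if_false, convexHull_singleton, mem_singleton_iff]) (Finset.range (k + 1))
    have hxa : ∀ j, j ∉ insert k S → x j = a j := by
      intro j hj
      simpa only [hj, if_false, convexHull_singleton, mem_singleton_iff] using hx j
    have hxA : ∀ j, x j ∈ convexHull ℝ (A j) := by
      intro j
      by_cases h : j ∈ insert k S
      · simpa only [h, if_true] using hx j
      · rw [hxa j h]; exact haA j
    have hTS : (T.filter (· ∈ insert k S)).card ≤ Module.finrank ℝ F :=
      (Finset.card_le_card (Finset.filter_subset _ _)).trans hTc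
    have hxsum : ∑ j ∈ Finset.range (k + 1), x j = ∑ j ∈ Finset.range (k + 1), w j := by
      rw [hxs, Finset.sum_range_succ, hsum, haw k le_rfl, Finset.sum_range_succ]
    refine ⟨x, T.filter (· ∈ insert k S), hxA, (Finset.filter_subset _ _).trans hT, hTS, ?_, ?_,
      hxsum, ?_⟩
    · intro j hj hjT
      by_cases h : j ∈ insert k S
      · have h' : j ∉ T := fun h' ↦ hjT (Finset.mem_filter.2 ⟨h', h⟩)
        simpa only [h, if_true] using hxT j (Finset.mem_range.2 hj) h'
      · rw [hxa j h]
        rw [Finset.mem_insert, not_or] at h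
        exact haS j (by omega) h.2
    · intro j hj
      have h : j ∉ insert k S := by
        rw [Finset.mem_insert, not_or]
        exact ⟨by omega, fun h ↦ by have := Finset.mem_range.1 (hSk h); omega⟩
      rw [hxa j h, haw j (by omega)]
    · intro i hi
      rcases hi.eq_or_lt with rfl | hi
      · exact ⟨x, _, hxA, hTS, fun _ _ _ ↦ rfl, fun _ _ h ↦ h, hxsum⟩
      · obtain ⟨p, T', hp, hT', hpa, hST, hps⟩ := hpre i (by omega)
        refine ⟨p, T', hp, hT', fun j hj hjT ↦ ?_, fun j hj hjT ↦ ?_, hps⟩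
        · rw [hpa j hj hjT, hxa]
          rw [Finset.mem_insert, not_or]
          exact ⟨by omega, fun h ↦ hjT (hST j hj h)⟩
        · have := (Finset.mem_filter.1 hjT).2
          rw [Finset.mem_insert] at this
          exact hST j hj (this.resolve_left (by omega))

/-- **Bárány–Grinberg**: there is a selection from bounded sets all of whose partial sums stay close
to those of prescribed points of the closed convex hulls. -/
theorem exists_selection_norm_sum_sub_le {F : Type*} [NormedAddCommGroup F]
    [NormedSpace ℝ F] [FiniteDimensional ℝ F] (A : ℕ → Set F) {M : ℝ}
    (hAM : ∀ i, A i ⊆ Metric.closedBall 0 M)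
    (w : ℕ → F) (hw : ∀ i, w i ∈ closure (convexHull ℝ (A i))) (N : ℕ) :
    ∃ a : ℕ → F, (∀ j, a j ∈ A j) ∧ ∀ k ≤ N,
      ‖∑ j ∈ Finset.range k, (a j - w j)‖ ≤ Module.finrank ℝ F * (2 * M) + 1 := by
  classical
  have happ : ∀ i, ∃ (w' : F) (B : Finset F), ↑B ⊆ A i ∧ w' ∈ convexHull ℝ (B : Set F) ∧
      ‖w' - w i‖ ≤ 1 / (N + 1) := by
    intro i
    obtain ⟨w', hw', hd⟩ := Metric.mem_closure_iff.1 (hw i) (1 / (N + 1)) (by positivity)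
    rw [convexHull_eq_union] at hw'
    simp only [mem_iUnion] at hw'
    obtain ⟨B, hB, -, hwB⟩ := hw'
    exact ⟨w', B, hB, hwB, by rw [← dist_eq_norm, dist_comm]; exact hd.le⟩
  choose w' B hBA hw'B hww' using happ
  obtain ⟨a, S, haA, -, -, haS, -, -, hpre⟩ :=
    exists_fractional_selection (fun i ↦ (B i : Set F)) (fun i ↦ (B i).finite_toSet) w' hw'B N
  have hne : ∀ j, ∃ b, b ∈ B j := fun j ↦ by
    have := convexHull_nonempty_iff.1 ⟨_, hw'B j⟩
    exact this
  choose b hb using hne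
  have hball : ∀ j, convexHull ℝ (B j : Set F) ⊆ Metric.closedBall 0 M := fun j ↦
    convexHull_min ((hBA j).trans (hAM j)) (convex_closedBall _ _)
  have hM : 0 ≤ M := by
    have := hball 0 (hw'B 0)
    rw [mem_closedBall_zero_iff] at this
    exact (norm_nonneg _).trans this
  set a' : ℕ → F := fun j ↦ if a j ∈ B j then a j else b j with ha'
  have ha'B : ∀ j, a' j ∈ B j := by
    intro j
    by_cases h : a j ∈ B j <;> simp [ha', h, hb j]
  refine ⟨a', fun j ↦ hBA j (ha'B j), fun k hk ↦ ?_⟩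
  obtain ⟨p, T, hp, hT, hpa, hST, hps⟩ := hpre k hk
  have e1 : ∑ j ∈ Finset.range k, (a' j - w j) =
      ∑ j ∈ Finset.range k, (a' j - p j) + ∑ j ∈ Finset.range k, (w' j - w j) := by
    simp only [Finset.sum_sub_distrib, hps]
    abel
  have b1 : ‖∑ j ∈ Finset.range k, (a' j - p j)‖ ≤ Module.finrank ℝ F * (2 * M) := by
    have : ∑ j ∈ Finset.range k, (a' j - p j) =
        ∑ j ∈ (Finset.range k).filter (· ∈ T), (a' j - p j) := by
      rw [Finset.sum_filter]
      refine Finset.sum_congr rfl fun j hj ↦ ?_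
      have hj := Finset.mem_range.1 hj
      split_ifs with h
      · rfl
      · have := haS j (by omega) (fun h' ↦ h (hST j hj h'))
        rw [hpa j hj h]
        simp [ha', Finset.mem_coe.1 this]
    rw [this]
    refine (norm_sum_le_of_le (f := fun j ↦ a' j - p j) (n := fun _ ↦ 2 * M) _
      fun j _ ↦ ?_).trans ?_
    · have h1 := hball j (subset_convexHull ℝ _ (ha'B j))
      have h2 := hball j (hp j)
      rw [mem_closedBall_zero_iff] at h1 h2
      linarith [norm_sub_le (a' j) (p j)]
    · rw [Finset.sum_const, nsmul_eq_mul]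
      gcongr
      refine (Finset.card_le_card fun j hj ↦ ?_).trans hT
      exact (Finset.mem_filter.1 hj).2
  have b2 : ‖∑ j ∈ Finset.range k, (w' j - w j)‖ ≤ 1 := by
    refine (norm_sum_le_of_le (n := fun _ ↦ 1 / ((N : ℝ) + 1)) _ fun j _ ↦ hww' j).trans ?_
    rw [Finset.sum_const, nsmul_eq_mul, Finset.card_range, mul_one_div, div_le_one (by positivity)]
    have : (k : ℝ) ≤ N := by exact_mod_cast hk
    linarith
  rw [e1]
  exact (norm_add_le _ _).trans (add_le_add b1 b2)

/-- Joint continuity of `φ`, with Lipschitz constant `L` in the state and bound `M`, uniformly over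
controls in `U`. -/
structure IsBoundedLipschitz {E V G : Type*} [NormedAddCommGroup E] [TopologicalSpace V]
    [NormedAddCommGroup G] (U : Set V) (φ : E → V → G) (L M : ℝ) : Prop where
  cont : Continuous fun p : E × V ↦ φ p.1 p.2
  lip : ∀ y y' : E, ∀ u ∈ U, ‖φ y u - φ y' u‖ ≤ L * ‖y - y'‖
  bdd : ∀ y : E, ∀ u ∈ U, ‖φ y u‖ ≤ M

/-- `y` solves the state equation from `y₀` with the admissible control `u`. -/
structure IsTrajectory {E V : Type*} [NormedAddCommGroup E] [NormedSpace ℝ E] [MeasurableSpace V]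
    (U : Set V) (f : E → V → E) (y₀ : E) (u : ℝ → V) (y : ℝ → E) : Prop where
  meas : Measurable u
  mem : ∀ t, 0 ≤ t → u t ∈ U
  cont : Continuous y
  eq : ∀ t, 0 ≤ t → y t = y₀ + ∫ s in (0 : ℝ)..t, f (y s) (u s)

theorem intervalIntegrable_of_norm_le {G : Type*} [NormedAddCommGroup G] {F : ℝ → G}
    (hF : StronglyMeasurable F) {M a b : ℝ}
    (hM : ∀ s ∈ uIoc a b, ‖F s‖ ≤ M) : IntervalIntegrable F volume a b := by
  refine (intervalIntegrable_const (c := M)).mono_fun' hF.aestronglyMeasurable ?_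
  exact (ae_restrict_iff' measurableSet_uIoc).2 (Filter.Eventually.of_forall hM)

section Trajectory

variable {E V G : Type*} [NormedAddCommGroup E] [NormedSpace ℝ E] [FiniteDimensional ℝ E]
  [TopologicalSpace V] [SecondCountableTopology V] [MeasurableSpace V] [BorelSpace V]
  [NormedAddCommGroup G] [NormedSpace ℝ G] [FiniteDimensional ℝ G]

theorem IsBoundedLipschitz.stronglyMeasurable_comp {U : Set V} {φ : E → V → G} {L M : ℝ}
    (hφ : IsBoundedLipschitz U φ L M) {y : ℝ → E} {u : ℝ → V} (hy : Continuous y)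
    (hu : Measurable u) : StronglyMeasurable fun s ↦ φ (y s) (u s) := by
  borelize E
  borelize G
  have := FiniteDimensional.proper ℝ E
  have := FiniteDimensional.proper ℝ G
  exact (hφ.cont.measurable.comp (hy.measurable.prodMk hu)).stronglyMeasurable

theorem IsBoundedLipschitz.intervalIntegrable {U : Set V} {φ : E → V → G} {L M : ℝ}
    (hφ : IsBoundedLipschitz U φ L M) {y : ℝ → E} {u : ℝ → V} (hy : Continuous y)
    (hu : Measurable u) (huU : ∀ t, 0 ≤ t → u t ∈ U) {a b : ℝ} (ha : 0 ≤ a) (hb : 0 ≤ b) :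
    IntervalIntegrable (fun s ↦ φ (y s) (u s)) volume a b :=
  intervalIntegrable_of_norm_le (hφ.stronglyMeasurable_comp hy hu) fun s hs ↦
    hφ.bdd _ _ (huU s ((le_min ha hb).trans hs.1.le))

/-- Every globally admissible measurable control has a trajectory: Banach's fixed point theorem in
an exponentially weighted sup norm. -/
theorem exists_isTrajectory {U : Set V} {f : E → V → E} {L M : ℝ}
    (hf : IsBoundedLipschitz U f L M) (hL : 0 ≤ L) (hM : 0 ≤ M) (y₀ : E) {u : ℝ → V}
    (hu : Measurable u) (huU : ∀ t, u t ∈ U) : ∃ y, IsTrajectory U f y₀ u y := by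
  have := FiniteDimensional.proper ℝ E
  set a : ℝ := L + 1 with ha
  have ha0 : 0 < a := by positivity
  let S : BoundedContinuousFunction ℝ E → ℝ → E := fun z s ↦ y₀ + exp (a * s) • z s
  have hS : ∀ z, Continuous (S z) := fun z ↦ by
    have := z.continuous
    fun_prop
  have hint : ∀ z b c, IntervalIntegrable (fun s ↦ f (S z s) (u s)) volume b c := fun z b c ↦
    intervalIntegrable_of_norm_le (hf.stronglyMeasurable_comp (hS z) hu)
      fun s _ ↦ hf.bdd _ _ (huU s)
  let P : BoundedContinuousFunction ℝ E → ℝ → E := fun z t ↦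
    exp (-(a * max t 0)) • ∫ s in (0 : ℝ)..(max t 0), f (S z s) (u s)
  have hP : ∀ z, Continuous (P z) := fun z ↦ by
    have h1 : Continuous fun t ↦ ∫ s in (0 : ℝ)..t, f (S z s) (u s) :=
      intervalIntegral.continuous_primitive (hint z) 0
    have h2 : Continuous fun t : ℝ ↦ max t 0 := by fun_prop
    exact (by fun_prop : Continuous fun t : ℝ ↦ exp (-(a * max t 0))).smul (h1.comp h2)
  have hPb : ∀ z t, ‖P z t‖ ≤ M := by
    intro z t
    have hτ : 0 ≤ max t 0 := le_max_right _ _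
    have h1 : ‖∫ s in (0 : ℝ)..(max t 0), f (S z s) (u s)‖ ≤ M * |max t 0 - 0| :=
      intervalIntegral.norm_integral_le_of_norm_le_const fun s _ ↦ hf.bdd _ _ (huU s)
    rw [sub_zero, abs_of_nonneg hτ] at h1
    have h2 : max t 0 ≤ exp (a * max t 0) := by
      nlinarith [add_one_le_exp (a * max t 0), mul_nonneg hL hτ]
    simp only [P]
    rw [norm_smul, norm_eq_abs, abs_exp, exp_neg, inv_mul_le_iff₀ (exp_pos _)]
    nlinarith
  let Φ : BoundedContinuousFunction ℝ E → BoundedContinuousFunction ℝ E := fun z ↦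
    BoundedContinuousFunction.ofNormedAddCommGroup (P z) (hP z) M (hPb z)
  have hΦ : ContractingWith (Real.toNNReal (L / a)) Φ := by
    refine ⟨?_, LipschitzWith.of_dist_le_mul fun z z' ↦ ?_⟩
    · rw [Real.toNNReal_lt_one, div_lt_one ha0]
      linarith
    rw [Real.coe_toNNReal _ (by positivity)]
    refine (BoundedContinuousFunction.dist_le (by positivity)).2 fun t ↦ ?_
    have hτ : 0 ≤ max t 0 := le_max_right _ _
    have h1 : ‖∫ s in (0 : ℝ)..(max t 0), (f (S z s) (u s) - f (S z' s) (u s))‖ ≤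
        ∫ s in (0 : ℝ)..(max t 0), L * dist z z' * exp (a * s) := by
      refine intervalIntegral.norm_integral_le_of_norm_le hτ
        (Filter.Eventually.of_forall fun s _ ↦ ?_)
        (Continuous.intervalIntegrable (by fun_prop) _ _)
      refine (hf.lip _ _ _ (huU s)).trans ?_
      have : S z s - S z' s = exp (a * s) • (z s - z' s) := by simp only [S]; module
      rw [this, norm_smul, norm_eq_abs, abs_exp, ← dist_eq_norm]
      have := BoundedContinuousFunction.dist_coe_le_dist (f := z) (g := z') s
      calc L * (exp (a * s) * dist (z s) (z' s)) ≤ L * (exp (a * s) * dist z z') := by gcongr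
        _ = _ := by ring
    rw [intervalIntegral.integral_const_mul, intervalIntegral.integral_comp_mul_left _ ha0.ne',
      integral_exp, intervalIntegral.integral_sub (hint z _ _) (hint z' _ _)] at h1
    have h2 : Φ z t - Φ z' t = exp (-(a * max t 0)) •
        ((∫ s in (0 : ℝ)..(max t 0), f (S z s) (u s)) -
          ∫ s in (0 : ℝ)..(max t 0), f (S z' s) (u s)) := by
      simp only [Φ, P, BoundedContinuousFunction.coe_ofNormedAddCommGroup, smul_sub]
    rw [dist_eq_norm, h2, norm_smul, norm_eq_abs, abs_exp, exp_neg, inv_mul_le_iff₀ (exp_pos _)]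
    refine h1.trans ?_
    rw [mul_zero, exp_zero, smul_eq_mul]
    have hd : 0 ≤ L * dist z z' * a⁻¹ := by positivity
    calc L * dist z z' * (a⁻¹ * (exp (a * max t 0) - 1))
        = L * dist z z' * a⁻¹ * exp (a * max t 0) - L * dist z z' * a⁻¹ := by ring
      _ ≤ L * dist z z' * a⁻¹ * exp (a * max t 0) := by linarith
      _ = _ := by rw [div_eq_mul_inv]; ring
  have hfix : Φ (hΦ.fixedPoint Φ) = hΦ.fixedPoint Φ := hΦ.fixedPoint_isFixedPt
  refine ⟨S (hΦ.fixedPoint Φ), hu, fun t _ ↦ huU t, hS _, fun t ht ↦ ?_⟩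
  have h1 : hΦ.fixedPoint Φ t = P (hΦ.fixedPoint Φ) t := (DFunLike.congr_fun hfix t).symm
  change y₀ + exp (a * t) • hΦ.fixedPoint Φ t = _
  rw [h1]
  simp only [P, max_eq_left ht]
  rw [smul_smul, ← exp_add, add_neg_cancel, exp_zero, one_smul]

theorem IsTrajectory.integral_eq_sub {U : Set V} {f : E → V → E} {L M : ℝ}
    (hf : IsBoundedLipschitz U f L M) {y₀ : E} {u : ℝ → V} {y : ℝ → E}
    (hy : IsTrajectory U f y₀ u y) {s t : ℝ} (hs : 0 ≤ s) (ht : 0 ≤ t) :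
    ∫ r in s..t, f (y r) (u r) = y t - y s := by
  have hi {b c : ℝ} (hb : 0 ≤ b) (hc : 0 ≤ c) := hf.intervalIntegrable hy.cont hy.meas hy.mem hb hc
  rw [hy.eq t ht, hy.eq s hs,
    ← intervalIntegral.integral_add_adjacent_intervals (hi le_rfl hs) (hi hs ht)]
  abel

theorem IsTrajectory.norm_sub_le {U : Set V} {f : E → V → E} {L M : ℝ}
    (hf : IsBoundedLipschitz U f L M) {y₀ : E} {u : ℝ → V} {y : ℝ → E}
    (hy : IsTrajectory U f y₀ u y) {s t : ℝ} (hs : 0 ≤ s) (hst : s ≤ t) :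
    ‖y t - y s‖ ≤ M * (t - s) := by
  rw [← hy.integral_eq_sub hf hs (hs.trans hst)]
  have := intervalIntegral.norm_integral_le_of_norm_le_const (a := s) (b := t)
    (f := fun r ↦ f (y r) (u r)) (C := M) fun r hr ↦ hf.bdd _ _ (hy.mem r ?_)
  · rwa [abs_of_nonneg (sub_nonneg.2 hst)] at this
  · rw [uIoc_of_le hst] at hr
    exact hs.trans hr.1.le

end Trajectory

/-- Discrete Grönwall inequality, with the growth rate enlarged to absorb the linear term. -/
theorem le_geometric_of_le_sum {e : ℕ → ℝ} {N : ℕ} {D M K L₀ L h : ℝ} (hh : 0 < h) (hK : 0 ≤ K)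
    (hL₀ : 0 ≤ L₀) (hL : L₀ < L) (hD : D * L ≤ K * (L - L₀)) (hM : M ≤ K * (L - L₀))
    (he : ∀ k ≤ N, e k ≤ D * h + M * h ^ 2 * k + h * L₀ * ∑ j ∈ Finset.range k, e j) :
    ∀ k ≤ N, e k ≤ K * h * (1 + L * h) ^ k := by
  intro k
  induction k using Nat.strong_induction_on with
  | _ k ih =>
    intro hk
    have hLpos : 0 < L := hL₀.trans_lt hL
    have hsum : L * h * ∑ j ∈ Finset.range k, (1 + L * h) ^ j = (1 + L * h) ^ k - 1 := by
      have := geom_sum_mul (1 + L * h) k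
      rw [add_sub_cancel_left] at this
      linarith
    have h1 : ∑ j ∈ Finset.range k, e j ≤ K * h * ∑ j ∈ Finset.range k, (1 + L * h) ^ j := by
      rw [Finset.mul_sum]
      refine Finset.sum_le_sum fun j hj ↦ ?_
      have := Finset.mem_range.1 hj
      exact ih j this (by omega)
    have h2 : 1 + k * (L * h) ≤ (1 + L * h) ^ k :=
      one_add_mul_le_pow (by nlinarith [mul_pos hLpos hh]) k
    set G := (1 + L * h) ^ k
    set Q := ∑ j ∈ Finset.range k, (1 + L * h) ^ j
    have h3 : e k ≤ D * h + M * h ^ 2 * k + h * L₀ * (K * h * Q) :=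
      (he k hk).trans (by gcongr)
    have hx : 0 ≤ (k : ℝ) * (L * h) := by positivity
    have h4 : L * (h * L₀ * (K * h * Q)) = h * (L₀ * K * (G - 1)) := by
      linear_combination h * L₀ * K * hsum
    have h5 : D * L + M * (k * (L * h)) ≤ K * (L - L₀) * (1 + k * (L * h)) := by nlinarith
    have h6 : K * (L - L₀) * (1 + k * (L * h)) ≤ K * (L - L₀) * G :=
      mul_le_mul_of_nonneg_left h2 (mul_nonneg hK (sub_nonneg.2 hL.le))
    have h7 : 0 ≤ L₀ * K := mul_nonneg hL₀ hK
    have h8 : h * (D * L + M * (k * (L * h)) + L₀ * K * (G - 1)) ≤ h * (K * L * G) :=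
      mul_le_mul_of_nonneg_left (by nlinarith) hh.le
    refine le_of_mul_le_mul_left ?_ hLpos
    calc L * e k ≤ L * (D * h + M * h ^ 2 * k + h * L₀ * (K * h * Q)) := by gcongr
      _ = h * (D * L + M * (k * (L * h)) + L₀ * K * (G - 1)) := by rw [mul_add, h4]; ring
      _ ≤ h * (K * L * G) := h8
      _ = _ := by ring

theorem exp_neg_mul_one_add_le (x : ℝ) : exp (-x) * (1 + x) ≤ 1 := by
  calc exp (-x) * (1 + x) ≤ exp (-x) * exp x := by gcongr; linarith [add_one_le_exp x]
    _ = 1 := by rw [← exp_add]; simp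

theorem mul_geom_sum_exp_le {lam h : ℝ} (hlam : 0 < lam) (hh : 0 < h) (hlh : lam * h < 1) (N : ℕ) :
    h * ∑ j ∈ Finset.range N, exp (-(lam * h)) ^ j ≤ 2 / lam := by
  have hx : 0 < lam * h := by positivity
  have h1 := geom_sum_mul_neg (exp (-(lam * h))) N
  have h2 : 0 ≤ exp (-(lam * h)) ^ N := by positivity
  have h3 : lam * h / 2 ≤ 1 - exp (-(lam * h)) := by
    have := exp_neg_mul_one_add_le (lam * h)
    nlinarith
  have h4 : 0 ≤ ∑ j ∈ Finset.range N, exp (-(lam * h)) ^ j := by positivity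
  rw [le_div_iff₀ hlam]
  nlinarith

theorem mul_sum_exp_sub_le {lam h : ℝ} (hlam : 0 < lam) (hh : 0 < h) (hlh : lam * h < 1) (N : ℕ) :
    h * ∑ j ∈ Finset.range N, (exp (-(lam * h)) ^ j - (1 - lam * h) ^ j) ≤ 2 * h := by
  have hx : 0 < lam * h := by positivity
  have h1 := geom_sum_mul_neg (exp (-(lam * h))) N
  have h2 := geom_sum_mul_neg (1 - lam * h) N
  have hqr : 1 - lam * h ≤ exp (-(lam * h)) := by linarith [add_one_le_exp (-(lam * h))]
  have h3 : (1 - lam * h) ^ N ≤ exp (-(lam * h)) ^ N :=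
    pow_le_pow_left₀ (by linarith) hqr N
  have h4 : exp (-(lam * h)) - (1 - lam * h) ≤ (lam * h) ^ 2 := by
    have := exp_neg_mul_one_add_le (lam * h)
    nlinarith [exp_pos (-(lam * h))]
  have h5 := mul_geom_sum_exp_le hlam hh hlh N
  rw [Finset.sum_sub_distrib]
  have h6 : 0 ≤ ∑ j ∈ Finset.range N, exp (-(lam * h)) ^ j := by positivity
  set R := ∑ j ∈ Finset.range N, exp (-(lam * h)) ^ j
  set Q := ∑ j ∈ Finset.range N, (1 - lam * h) ^ j
  rw [le_div_iff₀ hlam] at h5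
  have h7 : (lam * h) * (R - Q) ≤ (lam * h) ^ 2 * R := by nlinarith
  have h8 : R - Q ≤ lam * h * R := by
    refine le_of_mul_le_mul_left ?_ hx
    linarith
  nlinarith

/-- Abel summation against decreasing geometric weights. -/
theorem abs_sum_pow_mul_le {b : ℕ → ℝ} {q D : ℝ} (hq0 : 0 ≤ q) (hq1 : q ≤ 1) {N : ℕ}
    (hb : ∀ k ≤ N, |∑ j ∈ Finset.range k, b j| ≤ D) :
    |∑ j ∈ Finset.range N, q ^ j * b j| ≤ D := by
  have key : ∀ n, ∑ j ∈ Finset.range n, q ^ j * b j = q ^ n * ∑ j ∈ Finset.range n, b j +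
      (1 - q) * ∑ j ∈ Finset.range n, q ^ j * ∑ i ∈ Finset.range (j + 1), b i := by
    intro n
    induction n with
    | zero => simp
    | succ n ih =>
      rw [Finset.sum_range_succ, ih, Finset.sum_range_succ (fun j ↦ q ^ j * _),
        Finset.sum_range_succ b n]
      ring
  have h1 : |∑ j ∈ Finset.range N, q ^ j * ∑ i ∈ Finset.range (j + 1), b i| ≤
      ∑ j ∈ Finset.range N, q ^ j * D := by
    refine (Finset.abs_sum_le_sum_abs _ _).trans (Finset.sum_le_sum fun j hj ↦ ?_)
    rw [abs_mul, abs_of_nonneg (pow_nonneg hq0 j)]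
    gcongr
    exact hb _ (Finset.mem_range.1 hj)
  rw [← Finset.sum_mul] at h1
  have h2 := geom_sum_mul_neg q N
  rw [key]
  refine (abs_add_le _ _).trans ?_
  rw [abs_mul, abs_mul, abs_of_nonneg (pow_nonneg hq0 N), abs_of_nonneg (sub_nonneg.2 hq1)]
  calc _ ≤ q ^ N * D + (1 - q) * ((∑ j ∈ Finset.range N, q ^ j) * D) := by
        gcongr
        exact hb N le_rfl
    _ = (q ^ N + (∑ j ∈ Finset.range N, q ^ j) * (1 - q)) * D := by ring
    _ = D := by rw [h2]; ring

theorem mul_geom_sum_mul_le {lam L h : ℝ} (hL : 0 ≤ L) (hlam : L < lam) (hh : 0 < h)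
    (hlh : lam * h < 1) (N : ℕ) :
    h * ∑ j ∈ Finset.range N, (1 - lam * h) ^ j * (1 + L * h) ^ j ≤ 1 / (lam - L) := by
  have hLh : 0 ≤ L * h := by positivity
  have h1 : ∑ j ∈ Finset.range N, (1 - lam * h) ^ j * (1 + L * h) ^ j ≤
      ∑ j ∈ Finset.range N, (1 - (lam - L) * h) ^ j := by
    refine Finset.sum_le_sum fun j _ ↦ ?_
    rw [← mul_pow]
    refine pow_le_pow_left₀ (mul_nonneg (by linarith) (by linarith)) ?_ j
    nlinarith [mul_nonneg hLh (mul_nonneg (hL.trans hlam.le) hh.le)]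
  have h2 := geom_sum_mul_neg (1 - (lam - L) * h) N
  have h3 : 0 ≤ (1 - (lam - L) * h) ^ N := pow_nonneg (by nlinarith) N
  rw [le_div_iff₀ (sub_pos.2 hlam)]
  have := mul_le_mul_of_nonneg_left h1 (mul_nonneg hh.le (sub_pos.2 hlam).le)
  nlinarith

theorem IsTrajectory.norm_discounted_le {E V : Type*} [NormedAddCommGroup E] [NormedSpace ℝ E]
    [TopologicalSpace V] [MeasurableSpace V] {U : Set V} {f : E → V → E} {g : E → V → ℝ} {y₀ : E}
    {u : ℝ → V} {y : ℝ → E} {G Mg lam : ℝ}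
    (hg : IsBoundedLipschitz U g G Mg)
    (hy : IsTrajectory U f y₀ u y) {b t : ℝ} (hb : 0 ≤ b) (ht : t ∈ Ioi b) :
    ‖g (y t) (u t) * exp (-lam * t)‖ ≤ Mg * exp (-lam * t) := by
  rw [norm_mul, norm_eq_abs (exp _), abs_exp]
  gcongr
  exact hg.bdd _ _ (hy.mem t (hb.trans (le_of_lt ht)))

theorem IsTrajectory.abs_integral_Ioi_le {E V : Type*} [NormedAddCommGroup E] [NormedSpace ℝ E]
    [TopologicalSpace V] [MeasurableSpace V] {U : Set V} {f : E → V → E} {g : E → V → ℝ} {y₀ : E}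
    {u : ℝ → V} {y : ℝ → E} {G Mg lam : ℝ}
    (hg : IsBoundedLipschitz U g G Mg)
    (hy : IsTrajectory U f y₀ u y) (hlam : 0 < lam) {b : ℝ} (hb : 0 ≤ b) :
    |∫ t in Ioi b, g (y t) (u t) * exp (-lam * t)| ≤ exp (-lam * b) * (Mg / lam) := by
  rw [← norm_eq_abs]
  refine (norm_integral_le_of_norm_le ((integrableOn_exp_mul_Ioi (neg_lt_zero.2 hlam) b).const_mul
    Mg) ((ae_restrict_iff' measurableSet_Ioi).2 (Filter.Eventually.of_forall fun t ht ↦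
      hy.norm_discounted_le hg hb ht))).trans_eq ?_
  rw [integral_const_mul, integral_exp_mul_Ioi (neg_lt_zero.2 hlam)]
  field_simp

section Euler

variable {E V : Type*} [NormedAddCommGroup E] [NormedSpace ℝ E] [FiniteDimensional ℝ E]
  [TopologicalSpace V] [SecondCountableTopology V] [MeasurableSpace V] [BorelSpace V]
  {U : Set V} {f : E → V → E} {g : E → V → ℝ} {y₀ : E} {u : ℝ → V} {y : ℝ → E}
  {a : ℕ → V} {Y : ℕ → E}

theorem IsTrajectory.norm_integral_sub_frozen_le {L₀ M h : ℝ} (hf : IsBoundedLipschitz U f L₀ M)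
    (hL₀ : 0 ≤ L₀) (hM : 0 ≤ M) (hy : IsTrajectory U f y₀ u y) (hh : 0 < h) (j : ℕ) :
    ‖(∫ s in (j * h)..((j + 1 : ℕ) * h), f (y s) (u s)) -
      ∫ s in (j * h)..((j + 1 : ℕ) * h), f (y (j * h)) (u s)‖ ≤ L₀ * M * h ^ 2 := by
  have h0 : 0 ≤ (j : ℝ) * h := by positivity
  have h1 : (j : ℝ) * h ≤ (j + 1 : ℕ) * h := by push_cast; nlinarith
  rw [← intervalIntegral.integral_sub
    (hf.intervalIntegrable hy.cont hy.meas hy.mem h0 (h0.trans h1))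
    (hf.intervalIntegrable (y := fun _ ↦ y (j * h)) continuous_const hy.meas hy.mem h0
      (h0.trans h1))]
  refine (intervalIntegral.norm_integral_le_of_norm_le_const (C := L₀ * (M * h))
    fun s hs ↦ ?_).trans_eq ?_
  · rw [uIoc_of_le h1] at hs
    have h2 : s ≤ j * h + h := by have := hs.2; push_cast at this; linarith
    refine (hf.lip _ _ _ (hy.mem s (h0.trans hs.1.le))).trans ?_
    gcongr
    refine (hy.norm_sub_le hf h0 hs.1.le).trans ?_
    gcongr
    linarith
  · rw [abs_of_nonneg (sub_nonneg.2 h1)]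
    push_cast
    ring

/-- Distance between a trajectory and the Euler scheme for a sequence of controls that matches the
given control on average. -/
theorem IsTrajectory.norm_sub_euler_le {L₀ L M D K h : ℝ} (hf : IsBoundedLipschitz U f L₀ M)
    (hL₀ : 0 ≤ L₀) (hL : L₀ < L) (hM : 0 ≤ M) (hK : 0 ≤ K) (hDK : D * L ≤ K * (L - L₀))
    (hMK : L₀ * M ≤ K * (L - L₀)) (hy : IsTrajectory U f y₀ u y) (ha : ∀ j, a j ∈ U) (hh : 0 < h)
    (hY0 : Y 0 = y₀) (hY : ∀ j, Y (j + 1) = Y j + h • f (Y j) (a j)) {N : ℕ}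
    (hD : ∀ k ≤ N, ‖∑ j ∈ Finset.range k, (h • f (y (j * h)) (a j) -
      ∫ s in (j * h)..((j + 1 : ℕ) * h), f (y (j * h)) (u s))‖ ≤ D * h) :
    ∀ k ≤ N, ‖y (k * h) - Y k‖ ≤ K * h * (1 + L * h) ^ k := by
  refine le_geometric_of_le_sum (e := fun k ↦ ‖y (k * h) - Y k‖) (M := L₀ * M)
    hh hK hL₀ hL hDK hMK fun k hk ↦ ?_
  have hy0 : y 0 = y₀ := by simpa using hy.eq 0 le_rfl
  have e1 : y (k * h) - Y k = ∑ j ∈ Finset.range k,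
      ((∫ s in (j * h)..((j + 1 : ℕ) * h), f (y s) (u s)) -
        ∫ s in (j * h)..((j + 1 : ℕ) * h), f (y (j * h)) (u s)) -
      ∑ j ∈ Finset.range k, (h • f (y (j * h)) (a j) -
        ∫ s in (j * h)..((j + 1 : ℕ) * h), f (y (j * h)) (u s)) +
      ∑ j ∈ Finset.range k, h • (f (y (j * h)) (a j) - f (Y j) (a j)) := by
    have := Finset.sum_range_sub (fun j : ℕ ↦ y (j * h) - Y j) k
    simp only [Nat.cast_zero, zero_mul, hy0, hY0, sub_self, sub_zero] at this
    rw [← this, ← Finset.sum_sub_distrib, ← Finset.sum_add_distrib]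
    refine Finset.sum_congr rfl fun j _ ↦ ?_
    rw [hy.integral_eq_sub hf (by positivity) (by positivity), hY]
    module
  have b1 : ‖∑ j ∈ Finset.range k, ((∫ s in (j * h)..((j + 1 : ℕ) * h), f (y s) (u s)) -
        ∫ s in (j * h)..((j + 1 : ℕ) * h), f (y (j * h)) (u s))‖ ≤ L₀ * M * h ^ 2 * k := by
    refine (norm_sum_le_of_le _ fun j _ ↦
      hy.norm_integral_sub_frozen_le hf hL₀ hM hh j).trans_eq ?_
    rw [Finset.sum_const, Finset.card_range, nsmul_eq_mul]
    ring
  have b2 : ‖∑ j ∈ Finset.range k, h • (f (y (j * h)) (a j) - f (Y j) (a j))‖ ≤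
      h * L₀ * ∑ j ∈ Finset.range k, ‖y (j * h) - Y j‖ := by
    rw [Finset.mul_sum]
    refine norm_sum_le_of_le _ fun j _ ↦ ?_
    rw [norm_smul, norm_eq_abs, abs_of_pos hh, mul_assoc]
    gcongr
    exact hf.lip _ _ _ (ha j)
  rw [e1]
  refine (norm_add_le _ _).trans ?_
  have := _root_.norm_sub_le (∑ j ∈ Finset.range k,
      ((∫ s in (j * h)..((j + 1 : ℕ) * h), f (y s) (u s)) -
        ∫ s in (j * h)..((j + 1 : ℕ) * h), f (y (j * h)) (u s)))
      (∑ j ∈ Finset.range k, (h • f (y (j * h)) (a j) -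
        ∫ s in (j * h)..((j + 1 : ℕ) * h), f (y (j * h)) (u s)))
  linarith [hD k hk]

theorem IsTrajectory.abs_discounted_integral_sub_le {L₀ M G Mg lam h : ℝ}
    (hf : IsBoundedLipschitz U f L₀ M) (hM : 0 ≤ M) (hg : IsBoundedLipschitz U g G Mg) (hG : 0 ≤ G)
    (hMg : 0 ≤ Mg) (hy : IsTrajectory U f y₀ u y) (hlam : 0 < lam) (hh : 0 < h)
    (hlh : lam * h < 1) (j : ℕ) :
    |(∫ s in (j * h)..((j + 1 : ℕ) * h), g (y s) (u s) * exp (-lam * s)) -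
      (1 - lam * h) ^ j * ∫ s in (j * h)..((j + 1 : ℕ) * h), g (y (j * h)) (u s)| ≤
    h * (G * M * h * exp (-(lam * h)) ^ j +
      Mg * (exp (-(lam * h)) ^ j - exp (-(lam * h)) ^ (j + 1)) +
      Mg * (exp (-(lam * h)) ^ j - (1 - lam * h) ^ j)) := by
  have h0 : 0 ≤ (j : ℝ) * h := by positivity
  have h1 : (j : ℝ) * h ≤ (j + 1 : ℕ) * h := by push_cast; nlinarith
  have hr : ∀ i : ℕ, exp (-(lam * h)) ^ i = exp (-lam * (i * h)) := fun i ↦ by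
    rw [← exp_nat_mul]; ring_nf
  have hqr : (1 - lam * h) ^ j ≤ exp (-(lam * h)) ^ j :=
    pow_le_pow_left₀ (by linarith) (by linarith [add_one_le_exp (-(lam * h))]) j
  have hq : 0 ≤ (1 - lam * h) ^ j := pow_nonneg (by linarith) j
  rw [← intervalIntegral.integral_const_mul, ← intervalIntegral.integral_sub
    ((hg.intervalIntegrable hy.cont hy.meas hy.mem h0 (h0.trans h1)).mul_continuousOn
      (by fun_prop))
    ((hg.intervalIntegrable (y := fun _ ↦ y (j * h)) continuous_const hy.meas hy.mem h0
      (h0.trans h1)).const_mul _), ← norm_eq_abs]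
  refine (intervalIntegral.norm_integral_le_of_norm_le_const
    (C := G * M * h * exp (-(lam * h)) ^ j +
      Mg * (exp (-(lam * h)) ^ j - exp (-(lam * h)) ^ (j + 1)) +
      Mg * (exp (-(lam * h)) ^ j - (1 - lam * h) ^ j)) fun s hs ↦ ?_).trans_eq ?_
  · rw [uIoc_of_le h1] at hs
    have hu := hy.mem s (h0.trans hs.1.le)
    have h2 : s ≤ j * h + h := by have := hs.2; push_cast at this; linarith
    have e1 : exp (-lam * s) ≤ exp (-(lam * h)) ^ j := by
      rw [hr]; exact exp_le_exp.2 (by nlinarith [hs.1])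
    have e2 : exp (-(lam * h)) ^ (j + 1) ≤ exp (-lam * s) := by
      rw [hr]; exact exp_le_exp.2 (by nlinarith [hs.2])
    have e3 : ‖g (y s) (u s) - g (y (j * h)) (u s)‖ ≤ G * (M * h) := by
      refine (hg.lip _ _ _ hu).trans ?_
      gcongr
      refine (hy.norm_sub_le hf h0 hs.1.le).trans ?_
      gcongr
      linarith
    have e4 : g (y s) (u s) * exp (-lam * s) - (1 - lam * h) ^ j * g (y (j * h)) (u s) =
        (g (y s) (u s) - g (y (j * h)) (u s)) * exp (-lam * s) +
          g (y (j * h)) (u s) * (exp (-lam * s) - (1 - lam * h) ^ j) := by ring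
    have e5 : |exp (-lam * s) - (1 - lam * h) ^ j| ≤
        (exp (-(lam * h)) ^ j - exp (-(lam * h)) ^ (j + 1)) +
          (exp (-(lam * h)) ^ j - (1 - lam * h) ^ j) := by
      rw [abs_le]; constructor <;> linarith
    rw [e4]
    refine (norm_add_le _ _).trans ?_
    rw [norm_mul, norm_mul, norm_eq_abs (exp _), abs_exp, norm_eq_abs (exp _ - _), add_assoc,
      ← mul_add]
    have := hg.bdd (y (j * h)) _ hu
    calc _ ≤ G * (M * h) * exp (-(lam * h)) ^ j +
          Mg * ((exp (-(lam * h)) ^ j - exp (-(lam * h)) ^ (j + 1)) +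
            (exp (-(lam * h)) ^ j - (1 - lam * h) ^ j)) := by gcongr
      _ = _ := by ring
  · rw [abs_of_nonneg (sub_nonneg.2 h1)]
    push_cast
    ring

/-- Comparison of the discounted costs of a trajectory and of an Euler scheme whose controls match
the given control on average. -/
theorem IsTrajectory.abs_cost_sub_euler_le {L₀ L M G Mg D K lam h : ℝ}
    (hf : IsBoundedLipschitz U f L₀ M) (hL₀ : 0 ≤ L₀) (hL : L₀ < L) (hLlam : L < lam) (hM : 0 ≤ M)
    (hK : 0 ≤ K) (hDK : D * L ≤ K * (L - L₀)) (hMK : L₀ * M ≤ K * (L - L₀))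
    (hg : IsBoundedLipschitz U g G Mg) (hG : 0 ≤ G) (hMg : 0 ≤ Mg)
    (hy : IsTrajectory U f y₀ u y) (ha : ∀ j, a j ∈ U) (hh : 0 < h) (hlh : lam * h < 1)
    (hY0 : Y 0 = y₀) (hY : ∀ j, Y (j + 1) = Y j + h • f (Y j) (a j)) {N : ℕ}
    (hD : ∀ k ≤ N, ‖∑ j ∈ Finset.range k, (h • f (y (j * h)) (a j) -
      ∫ s in (j * h)..((j + 1 : ℕ) * h), f (y (j * h)) (u s))‖ ≤ D * h)
    (hD' : ∀ k ≤ N, |∑ j ∈ Finset.range k, (h * g (y (j * h)) (a j) -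
      ∫ s in (j * h)..((j + 1 : ℕ) * h), g (y (j * h)) (u s))| ≤ D * h) :
    |(∫ t in Ici (0 : ℝ), g (y t) (u t) * exp (-lam * t)) -
      ∑ j ∈ Finset.range N, (1 - lam * h) ^ j * (h * g (Y j) (a j))| ≤
    (2 * G * M / lam + 3 * Mg + D + G * K / (lam - L)) * h +
      exp (-(lam * h)) ^ N * (Mg / lam) := by
  have hlam : 0 < lam := (hL₀.trans_lt hL).trans hLlam
  have hNh : 0 ≤ (N : ℝ) * h := by positivity
  have hi {b c : ℝ} (hb : 0 ≤ b) (hc : 0 ≤ c) :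
      IntervalIntegrable (fun t ↦ g (y t) (u t) * exp (-lam * t)) volume b c :=
    (hg.intervalIntegrable hy.cont hy.meas hy.mem hb hc).mul_continuousOn (by fun_prop)
  have hIoi : IntegrableOn (fun t ↦ g (y t) (u t) * exp (-lam * t)) (Ioi (N * h)) := by
    refine ((integrableOn_exp_mul_Ioi (neg_lt_zero.2 hlam) (N * h)).const_mul Mg).mono' ?_ ?_
    · exact ((hg.stronglyMeasurable_comp hy.cont hy.meas).mul
        (by fun_prop : Continuous fun t ↦ exp (-lam * t)).stronglyMeasurable).aestronglyMeasurable
    · exact (ae_restrict_iff' measurableSet_Ioi).2 (Filter.Eventually.of_forall fun t ht ↦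
        hy.norm_discounted_le hg hNh ht)
  have htail := hy.abs_integral_Ioi_le hg hlam hNh
  have hr : exp (-lam * (N * h)) = exp (-(lam * h)) ^ N := by rw [← exp_nat_mul]; ring_nf
  rw [hr] at htail
  have hsplit : ∫ t in Ici (0 : ℝ), g (y t) (u t) * exp (-lam * t) =
      ∑ j ∈ Finset.range N, (∫ s in (j * h)..((j + 1 : ℕ) * h), g (y s) (u s) * exp (-lam * s)) +
        ∫ t in Ioi (N * h), g (y t) (u t) * exp (-lam * t) := by
    rw [integral_Ici_eq_integral_Ioi, intervalIntegral.sum_integral_adjacent_intervals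
      (a := fun j : ℕ ↦ (j : ℝ) * h) fun j _ ↦ hi (by positivity) (by positivity)]
    simp only [Nat.cast_zero, zero_mul]
    exact (intervalIntegral.integral_interval_add_Ioi' (hi le_rfl hNh) hIoi).symm
  have hq0 : 0 ≤ 1 - lam * h := by linarith
  have hq1 : 1 - lam * h ≤ 1 := by nlinarith [mul_pos hlam hh]
  -- freezing the state and the discount factor on each step
  have b1 : |∑ j ∈ Finset.range N,
      ((∫ s in (j * h)..((j + 1 : ℕ) * h), g (y s) (u s) * exp (-lam * s)) -
        (1 - lam * h) ^ j * ∫ s in (j * h)..((j + 1 : ℕ) * h), g (y (j * h)) (u s))| ≤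
      (2 * G * M / lam + 3 * Mg) * h := by
    refine (Finset.abs_sum_le_sum_abs _ _).trans ((Finset.sum_le_sum fun j _ ↦
      hy.abs_discounted_integral_sub_le hf hM hg hG hMg hlam hh hlh j).trans ?_)
    have s1 := mul_geom_sum_exp_le hlam hh hlh N
    have s2 := mul_sum_exp_sub_le hlam hh hlh N
    have s3 := Finset.sum_range_sub' (fun j ↦ exp (-(lam * h)) ^ j) N
    rw [← Finset.mul_sum, Finset.sum_add_distrib, Finset.sum_add_distrib, ← Finset.mul_sum,
      ← Finset.mul_sum, ← Finset.mul_sum, s3, pow_zero]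
    have s4 : 0 ≤ exp (-(lam * h)) ^ N := by positivity
    have t1 := mul_le_mul_of_nonneg_left s1 (mul_nonneg (mul_nonneg hG hM) hh.le)
    have t2 := mul_le_mul_of_nonneg_left s2 hMg
    have t3 := mul_nonneg (mul_nonneg hh.le hMg) s4
    have t4 : (2 * G * M / lam + 3 * Mg) * h = G * M * h * (2 / lam) + 3 * Mg * h := by ring
    rw [t4]
    nlinarith
  -- averaging of the running cost
  have b2 := abs_sum_pow_mul_le hq0 hq1 hD'
  have b3 : |∑ j ∈ Finset.range N,
      (1 - lam * h) ^ j * (h * (g (y (j * h)) (a j) - g (Y j) (a j)))| ≤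
      G * K / (lam - L) * h := by
    have he := hy.norm_sub_euler_le hf hL₀ hL hM hK hDK hMK ha hh hY0 hY hD
    refine (Finset.abs_sum_le_sum_abs _ _).trans ((Finset.sum_le_sum
      (g := fun j ↦ G * K * h * (h * ((1 - lam * h) ^ j * (1 + L * h) ^ j)))
      fun j hj ↦ ?_).trans ?_)
    · rw [abs_mul, abs_mul, abs_of_nonneg (pow_nonneg hq0 j), abs_of_pos hh]
      have : |g (y (j * h)) (a j) - g (Y j) (a j)| ≤ G * (K * h * (1 + L * h) ^ j) :=
        (hg.lip _ _ _ (ha j)).trans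
          (mul_le_mul_of_nonneg_left (he j (Finset.mem_range.1 hj).le) hG)
      calc _ ≤ (1 - lam * h) ^ j * (h * (G * (K * h * (1 + L * h) ^ j))) := by gcongr
        _ = _ := by ring
    · rw [← Finset.mul_sum, ← Finset.mul_sum]
      have := mul_le_mul_of_nonneg_left
        (mul_geom_sum_mul_le (hL₀.trans hL.le) hLlam hh hlh N) (mul_nonneg (mul_nonneg hG hK) hh.le)
      refine this.trans_eq ?_
      ring
  have hdecomp : ∑ j ∈ Finset.range N,
        (∫ s in (j * h)..((j + 1 : ℕ) * h), g (y s) (u s) * exp (-lam * s)) -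
      ∑ j ∈ Finset.range N, (1 - lam * h) ^ j * (h * g (Y j) (a j)) =
      ∑ j ∈ Finset.range N,
        ((∫ s in (j * h)..((j + 1 : ℕ) * h), g (y s) (u s) * exp (-lam * s)) -
          (1 - lam * h) ^ j * ∫ s in (j * h)..((j + 1 : ℕ) * h), g (y (j * h)) (u s)) -
      ∑ j ∈ Finset.range N, (1 - lam * h) ^ j * (h * g (y (j * h)) (a j) -
          ∫ s in (j * h)..((j + 1 : ℕ) * h), g (y (j * h)) (u s)) +
      ∑ j ∈ Finset.range N, (1 - lam * h) ^ j * (h * (g (y (j * h)) (a j) - g (Y j) (a j))) := by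
    rw [← Finset.sum_sub_distrib, ← Finset.sum_sub_distrib, ← Finset.sum_add_distrib]
    refine Finset.sum_congr rfl fun j _ ↦ ?_
    ring
  rw [hsplit, add_sub_right_comm, hdecomp]
  rw [abs_le] at b1 b2 b3 htail ⊢
  constructor <;> linarith [b1.1, b1.2, b2.1, b2.2, b3.1, b3.2, htail.1, htail.2]

end Euler

theorem integral_comp_floor_div {E : Type*} [NormedAddCommGroup E] [NormedSpace ℝ E]
    [CompleteSpace E] {h : ℝ} (hh : 0 < h) (F : ℕ → E) (j : ℕ) :
    ∫ s in (j * h)..((j + 1 : ℕ) * h), F ⌊s / h⌋₊ = h • F j := by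
  have h1 : (j : ℝ) * h ≤ (j + 1 : ℕ) * h := by push_cast; nlinarith
  have : ∫ s in (j * h)..((j + 1 : ℕ) * h), F ⌊s / h⌋₊ =
      ∫ s in (j * h)..((j + 1 : ℕ) * h), F j := by
    rw [intervalIntegral.integral_of_le h1, intervalIntegral.integral_of_le h1,
      integral_Ioc_eq_integral_Ioo, integral_Ioc_eq_integral_Ioo]
    refine setIntegral_congr_fun measurableSet_Ioo fun s hs ↦ ?_
    have hs0 : 0 ≤ s := le_trans (by positivity) hs.1.le
    have : ⌊s / h⌋₊ = j := by
      rw [Nat.floor_eq_iff (by positivity), le_div_iff₀ hh, div_lt_iff₀ hh]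
      exact ⟨hs.1.le, by exact_mod_cast hs.2⟩
    simp only [this]
  rw [this, intervalIntegral.integral_const]
  congr 1
  push_cast
  ring

theorem IsBoundedLipschitz.prodMk {E V : Type*} [NormedAddCommGroup E] [TopologicalSpace V]
    {U : Set V} {f : E → V → E} {g : E → V → ℝ} {L M G Mg : ℝ} (hf : IsBoundedLipschitz U f L M)
    (hM : 0 ≤ M) (hg : IsBoundedLipschitz U g G Mg) (hMg : 0 ≤ Mg) :
    IsBoundedLipschitz U (fun y v ↦ (f y v, g y v)) (max L G) (M + Mg) where
  cont := hf.cont.prodMk hg.cont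
  lip y y' v hv := by
    rw [Prod.mk_sub_mk, Prod.norm_mk]
    refine max_le ((hf.lip _ _ _ hv).trans ?_) ((hg.lip _ _ _ hv).trans ?_) <;> gcongr <;> simp
  bdd y v hv := by
    rw [Prod.norm_mk]
    exact max_le ((hf.bdd _ _ hv).trans (by linarith)) ((hg.bdd _ _ hv).trans (by linarith))

section Selection

variable {E V : Type*} [NormedAddCommGroup E] [NormedSpace ℝ E] [FiniteDimensional ℝ E]
  [TopologicalSpace V] [SecondCountableTopology V] [MeasurableSpace V] [BorelSpace V]
  {U : Set V} {f : E → V → E} {g : E → V → ℝ} {y₀ : E} {u : ℝ → V} {y : ℝ → E}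

/-- A measurable control can be replaced by a sequence of controls whose effect on the dynamics and
on the cost agrees with that of the original one up to an error of a single step. -/
theorem IsTrajectory.exists_controls {L M G Mg h : ℝ} (hf : IsBoundedLipschitz U f L M)
    (hM : 0 ≤ M) (hg : IsBoundedLipschitz U g G Mg) (hMg : 0 ≤ Mg)
    (hy : IsTrajectory U f y₀ u y) (hh : 0 < h) (N : ℕ) :
    ∃ a : ℕ → V, (∀ j, a j ∈ U) ∧
      (∀ k ≤ N, ‖∑ j ∈ Finset.range k, (h • f (y (j * h)) (a j) -
        ∫ s in (j * h)..((j + 1 : ℕ) * h), f (y (j * h)) (u s))‖ ≤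
          (Module.finrank ℝ (E × ℝ) * (2 * (M + Mg)) + 1) * h) ∧
      ∀ k ≤ N, |∑ j ∈ Finset.range k, (h * g (y (j * h)) (a j) -
        ∫ s in (j * h)..((j + 1 : ℕ) * h), g (y (j * h)) (u s))| ≤
          (Module.finrank ℝ (E × ℝ) * (2 * (M + Mg)) + 1) * h := by
  have hp := hf.prodMk hM hg hMg
  set φ : E → V → E × ℝ := fun y v ↦ (f y v, g y v)
  have h0 : ∀ j : ℕ, 0 ≤ (j : ℝ) * h := fun j ↦ by positivity
  have h1 : ∀ j : ℕ, (j : ℝ) * h < (j + 1 : ℕ) * h := fun j ↦ by push_cast; nlinarith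
  have hint : ∀ j : ℕ, IntervalIntegrable (fun s ↦ φ (y (j * h)) (u s)) volume
      (j * h) ((j + 1 : ℕ) * h) := fun j ↦
    hp.intervalIntegrable (y := fun _ ↦ y (j * h)) continuous_const hy.meas hy.mem (h0 j) (h0 _)
  set w : ℕ → E × ℝ := fun j : ℕ ↦ ⨍ s in (j * h)..((j + 1 : ℕ) * h), φ (y (j * h)) (u s)
    with hw_def
  have hw : ∀ j : ℕ, w j ∈ closure (convexHull ℝ (φ (y (j * h)) '' U)) := by
    intro j
    rw [hw_def]
    simp only
    rw [uIoc_of_le (h1 j).le]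
    refine (convex_convexHull ℝ _).set_average_mem_closure ?_ ?_ ?_ ?_
    · rw [Real.volume_Ioc, Ne, ENNReal.ofReal_eq_zero, not_le]
      linarith [h1 j]
    · rw [Real.volume_Ioc]; exact ENNReal.ofReal_ne_top
    · refine (ae_restrict_iff' measurableSet_Ioc).2 (Filter.Eventually.of_forall fun s hs ↦ ?_)
      exact subset_convexHull ℝ _ ⟨u s, hy.mem s ((h0 j).trans hs.1.le), rfl⟩
    · exact (intervalIntegrable_iff_integrableOn_Ioc_of_le (h1 j).le).1 (hint j)
  obtain ⟨b, hb, hbs⟩ := exists_selection_norm_sum_sub_le (fun j : ℕ ↦ φ (y (j * h)) '' U)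
    (M := M + Mg) (fun j ↦ by
      rintro _ ⟨v, hv, rfl⟩
      rw [mem_closedBall_zero_iff]
      exact hp.bdd _ _ hv) w hw N
  choose a haU hab using hb
  have hhw : ∀ j : ℕ, h • w j = ∫ s in (j * h)..((j + 1 : ℕ) * h), φ (y (j * h)) (u s) := by
    intro j
    have e : ((j + 1 : ℕ) : ℝ) * h - j * h = h := by push_cast; ring
    rw [hw_def]
    simp only
    rw [interval_average_eq, e, smul_inv_smul₀ hh.ne']
  have hsum : ∀ k ≤ N, ‖∑ j ∈ Finset.range k, (h • φ (y (j * h)) (a j) -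
      ∫ s in (j * h)..((j + 1 : ℕ) * h), φ (y (j * h)) (u s))‖ ≤
        (Module.finrank ℝ (E × ℝ) * (2 * (M + Mg)) + 1) * h := by
    intro k hk
    have : ∑ j ∈ Finset.range k, (h • φ (y (j * h)) (a j) -
        ∫ s in (j * h)..((j + 1 : ℕ) * h), φ (y (j * h)) (u s)) =
        h • ∑ j ∈ Finset.range k, (b j - w j) := by
      rw [Finset.smul_sum]
      refine Finset.sum_congr rfl fun j _ ↦ ?_
      rw [smul_sub, hhw, hab]
    rw [this, norm_smul, norm_eq_abs, abs_of_pos hh, mul_comm]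
    exact mul_le_mul_of_nonneg_right (hbs k hk) hh.le
  refine ⟨a, haU, fun k hk ↦ ?_, fun k hk ↦ ?_⟩
  · refine le_trans (le_of_eq_of_le ?_ (norm_fst_le _)) (hsum k hk)
    rw [Prod.fst_sum]
    congr 1
    refine Finset.sum_congr rfl fun j _ ↦ ?_
    rw [Prod.fst_sub, Prod.smul_fst]
    congr 1
    exact ((ContinuousLinearMap.fst ℝ E ℝ).intervalIntegral_comp_comm (hint j))
  · rw [← norm_eq_abs]
    refine le_trans (le_of_eq_of_le ?_ (norm_snd_le _)) (hsum k hk)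
    rw [Prod.snd_sum]
    congr 1
    refine Finset.sum_congr rfl fun j _ ↦ ?_
    rw [Prod.snd_sub, Prod.smul_snd]
    congr 1
    exact ((ContinuousLinearMap.snd ℝ E ℝ).intervalIntegral_comp_comm (hint j))

end Selection

theorem le_sum_pow_mul_add {q : ℝ} (hq : 0 ≤ q) {x c : ℕ → ℝ}
    (hx : ∀ j, x j ≤ q * x (j + 1) + c j) (N : ℕ) :
    x 0 ≤ ∑ j ∈ Finset.range N, q ^ j * c j + q ^ N * x N := by
  induction N with
  | zero => simp
  | succ N ih =>
    rw [Finset.sum_range_succ, pow_succ]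
    nlinarith [mul_le_mul_of_nonneg_left (hx N) (pow_nonneg hq N)]

theorem le_of_forall_le_add_pow_mul {a b c r : ℝ} (hr : 0 ≤ r) (hr1 : r < 1)
    (h : ∀ N : ℕ, a ≤ b + r ^ N * c) : a ≤ b := by
  refine ge_of_tendsto' (f := fun N : ℕ ↦ b + r ^ N * c) (x := Filter.atTop) ?_ h
  simpa using ((tendsto_pow_atTop_nhds_zero_of_lt_one hr hr1).mul_const c).const_add b

section DynamicProgramming

variable {E V : Type*} [NormedAddCommGroup E] [NormedSpace ℝ E] [FiniteDimensional ℝ E]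
  [TopologicalSpace V] [SecondCountableTopology V] [MeasurableSpace V] [BorelSpace V]
  {U : Set V} {f : E → V → E} {g : E → V → ℝ} {y₀ : E} {u : ℝ → V} {y : ℝ → E}
  {L₀ L M G Mg D K lam h B : ℝ} {w : E → ℝ}

/-- A bounded subsolution of the semidiscrete dynamic programming equation lies below the cost of
every trajectory, up to an error of order `h`. -/
theorem IsTrajectory.subsolution_le_cost_add
    (hf : IsBoundedLipschitz U f L₀ M) (hL₀ : 0 ≤ L₀) (hL : L₀ < L) (hLlam : L < lam) (hM : 0 ≤ M)
    (hK : 0 ≤ K) (hMK : L₀ * M ≤ K * (L - L₀))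
    (hg : IsBoundedLipschitz U g G Mg) (hG : 0 ≤ G) (hMg : 0 ≤ Mg)
    (hD : D = Module.finrank ℝ (E × ℝ) * (2 * (M + Mg)) + 1) (hDK : D * L ≤ K * (L - L₀))
    (hh : 0 < h) (hlh : lam * h < 1) (hwB : ∀ x, |w x| ≤ B)
    (hw : ∀ x, ∀ v ∈ U, w x ≤ (1 - lam * h) * w (x + h • f x v) + h * g x v)
    (hy : IsTrajectory U f y₀ u y) :
    w y₀ ≤ (∫ t in Ici (0 : ℝ), g (y t) (u t) * exp (-lam * t)) +
      (2 * G * M / lam + 3 * Mg + D + G * K / (lam - L)) * h := by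
  have hlam : 0 < lam := (hL₀.trans_lt hL).trans hLlam
  have hq : 0 ≤ 1 - lam * h := by linarith
  refine le_of_forall_le_add_pow_mul (c := Mg / lam + B) (exp_pos (-(lam * h))).le
    (exp_lt_one_iff.2 (neg_lt_zero.2 (mul_pos hlam hh))) fun N ↦ ?_
  obtain ⟨a, ha, hD₁, hD₂⟩ := hy.exists_controls hf hM hg hMg hh N
  rw [← hD] at hD₁ hD₂
  let Y : ℕ → E := fun k ↦ Nat.rec y₀ (fun j x ↦ x + h • f x (a j)) k
  have h1 := hy.abs_cost_sub_euler_le hf hL₀ hL hLlam hM hK hDK hMK hg hG hMg ha hh hlh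
    (Y := Y) rfl (fun _ ↦ rfl) hD₁ hD₂
  have h2 := le_sum_pow_mul_add hq (x := fun j ↦ w (Y j)) (c := fun j ↦ h * g (Y j) (a j))
    (fun j ↦ hw (Y j) _ (ha j)) N
  have h3 : (1 - lam * h) ^ N * w (Y N) ≤ exp (-(lam * h)) ^ N * B := by
    refine (mul_le_mul_of_nonneg_left ((le_abs_self _).trans (hwB _)) (pow_nonneg hq N)).trans ?_
    have := (abs_nonneg _).trans (hwB y₀)
    gcongr
    linarith [add_one_le_exp (-(lam * h))]
  have h4 := (abs_le.1 h1).1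
  change w y₀ ≤ _ at h2
  linarith

/-- A bounded supersolution of the semidiscrete dynamic programming equation lies above the cost of
some trajectory, up to an error of order `h`. -/
theorem exists_isTrajectory_cost_le_supersolution_add
    (hf : IsBoundedLipschitz U f L₀ M) (hL₀ : 0 ≤ L₀) (hL : L₀ < L) (hLlam : L < lam) (hM : 0 ≤ M)
    (hK : 0 ≤ K) (hMK : L₀ * M ≤ K * (L - L₀))
    (hg : IsBoundedLipschitz U g G Mg) (hG : 0 ≤ G) (hMg : 0 ≤ Mg)
    (hD : 0 ≤ D) (hDK : D * L ≤ K * (L - L₀))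
    (hh : 0 < h) (hlh : lam * h < 1) (hwB : ∀ x, |w x| ≤ B)
    (hw : ∀ x, ∃ v ∈ U, (1 - lam * h) * w (x + h • f x v) + h * g x v ≤ w x) (y₀ : E) :
    ∃ (u : ℝ → V) (y : ℝ → E), IsTrajectory U f y₀ u y ∧
      (∫ t in Ici (0 : ℝ), g (y t) (u t) * exp (-lam * t)) ≤
        w y₀ + (2 * G * M / lam + 3 * Mg + D + G * K / (lam - L)) * h := by
  have := FiniteDimensional.complete ℝ E
  have hlam : 0 < lam := (hL₀.trans_lt hL).trans hLlam
  have hq : 0 ≤ 1 - lam * h := by linarith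
  choose κ hκU hκ using hw
  let Y : ℕ → E := fun k ↦ Nat.rec y₀ (fun _ x ↦ x + h • f x (κ x)) k
  have hmeas : Measurable fun t : ℝ ↦ κ (Y ⌊t / h⌋₊) :=
    (measurable_from_nat (f := fun j ↦ κ (Y j))).comp
      (Nat.measurable_floor.comp (measurable_id.div_const h))
  obtain ⟨y, hy⟩ := exists_isTrajectory hf hL₀ hM y₀ hmeas fun t ↦ hκU _
  refine ⟨_, y, hy, le_of_forall_le_add_pow_mul (c := Mg / lam + B) (exp_pos (-(lam * h))).le
    (exp_lt_one_iff.2 (neg_lt_zero.2 (mul_pos hlam hh))) fun N ↦ ?_⟩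
  have h1 := hy.abs_cost_sub_euler_le (a := fun j ↦ κ (Y j)) (N := N) hf hL₀ hL hLlam hM hK hDK hMK
    hg hG hMg (fun j ↦ hκU _) hh hlh (Y := Y) rfl (fun _ ↦ rfl)
    (fun k _ ↦ by
      rw [Finset.sum_eq_zero fun j _ ↦ by
        rw [integral_comp_floor_div hh (fun i ↦ f (y (j * h)) (κ (Y i))), sub_self], norm_zero]
      positivity)
    (fun k _ ↦ by
      rw [Finset.sum_eq_zero fun j _ ↦ by
        rw [integral_comp_floor_div hh (fun i ↦ g (y (j * h)) (κ (Y i))), smul_eq_mul, sub_self],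
        abs_zero]
      positivity)
  have h2 := le_sum_pow_mul_add hq (x := fun j ↦ -w (Y j)) (c := fun j ↦ -(h * g (Y j) (κ (Y j))))
    (fun j ↦ by
      have : (1 - lam * h) * w (Y (j + 1)) + h * g (Y j) (κ (Y j)) ≤ w (Y j) := hκ (Y j)
      linarith) N
  have h3 : (1 - lam * h) ^ N * -w (Y N) ≤ exp (-(lam * h)) ^ N * B := by
    refine (mul_le_mul_of_nonneg_left ((neg_le_abs _).trans (hwB _)) (pow_nonneg hq N)).trans ?_
    have := (abs_nonneg _).trans (hwB y₀)
    gcongr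
    linarith [add_one_le_exp (-(lam * h))]
  have h4 := (abs_le.1 h1).2
  change -w y₀ ≤ _ at h2
  simp only [mul_neg, Finset.sum_neg_distrib] at h2 h3
  linarith

end DynamicProgramming

/-- Theorem 2.1 (semidiscrete error bound): there is a constant `C ≥ 0` such that for
every step size `h ∈ (0, 1/λ)` and every bounded continuous solution `v_h` of the
semidiscrete dynamic programming equation, `sup_y |v y - v_h y| ≤ C h`. -/
theorem semidiscrete_error_bound {n m : ℕ}
    (Uad : Set (EuclideanSpace ℝ (Fin m)))
    (hUad_comp : IsCompact Uad) (hUad_conv : Convex ℝ Uad) (hUad_ne : Uad.Nonempty)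
    (f : EuclideanSpace ℝ (Fin n) → EuclideanSpace ℝ (Fin m) → EuclideanSpace ℝ (Fin n))
    (g : EuclideanSpace ℝ (Fin n) → EuclideanSpace ℝ (Fin m) → ℝ)
    (Lf Mf Cf Lg Mg Cg lam : ℝ)
    (hf_cont : Continuous fun p : EuclideanSpace ℝ (Fin n) × EuclideanSpace ℝ (Fin m) => f p.1 p.2)
    (hf_lip : ∀ y y' : EuclideanSpace ℝ (Fin n), ∀ u ∈ Uad, ‖f y u - f y' u‖ ≤ Lf * ‖y - y'‖)
    (hf_bdd : ∀ y : EuclideanSpace ℝ (Fin n), ∀ u ∈ Uad, ‖f y u‖ ≤ Mf)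
    (hf_sc : ∀ y z : EuclideanSpace ℝ (Fin n), ∀ u ∈ Uad,
      ‖f (y + z) u - (2 : ℝ) • f y u + f (y - z) u‖ ≤ Cf * ‖z‖ ^ 2)
    (hg_cont : Continuous fun p : EuclideanSpace ℝ (Fin n) × EuclideanSpace ℝ (Fin m) => g p.1 p.2)
    (hg_lip : ∀ y y' : EuclideanSpace ℝ (Fin n), ∀ u ∈ Uad, |g y u - g y' u| ≤ Lg * ‖y - y'‖)
    (hg_bdd : ∀ y : EuclideanSpace ℝ (Fin n), ∀ u ∈ Uad, |g y u| ≤ Mg)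
    (hg_sc : ∀ y z : EuclideanSpace ℝ (Fin n), ∀ u ∈ Uad,
      |g (y + z) u - 2 * g y u + g (y - z) u| ≤ Cg * ‖z‖ ^ 2)
    (hlam : max (2 * Lg) Lf < lam)
    (v : EuclideanSpace ℝ (Fin n) → ℝ)
    (hv : ∀ y0 : EuclideanSpace ℝ (Fin n), v y0 = sInf {c : ℝ |
      ∃ (u : ℝ → EuclideanSpace ℝ (Fin m)) (y : ℝ → EuclideanSpace ℝ (Fin n)),
        Measurable u ∧ (∀ t, 0 ≤ t → u t ∈ Uad) ∧ Continuous y ∧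
        (∀ t, 0 ≤ t → y t = y0 + ∫ s in (0 : ℝ)..t, f (y s) (u s)) ∧
        c = ∫ t in Ici (0 : ℝ), g (y t) (u t) * exp (-lam * t)}) :
    ∃ C, 0 ≤ C ∧ ∀ h ∈ Ioo (0 : ℝ) (1 / lam),
      ∀ vh : EuclideanSpace ℝ (Fin n) → ℝ, Continuous vh → (∃ B, ∀ y, |vh y| ≤ B) →
        (∀ y : EuclideanSpace ℝ (Fin n),
          IsLeast {c : ℝ | ∃ u ∈ Uad,
            c = (1 - lam * h) * vh (y + h • f y u) + h * g y u} (vh y)) →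
        ∀ y : EuclideanSpace ℝ (Fin n), |v y - vh y| ≤ C * h := by
  by_cases hlam0 : 0 < lam
  swap
  · refine ⟨0, le_rfl, fun h hh ↦ absurd (hh.1.trans hh.2) ?_⟩
    rw [one_div, inv_pos]
    exact hlam0
  obtain ⟨u₀, hu₀⟩ := hUad_ne
  have hM : 0 ≤ Mf := (norm_nonneg _).trans (hf_bdd 0 u₀ hu₀)
  have hMg : 0 ≤ Mg := (abs_nonneg _).trans (hg_bdd 0 u₀ hu₀)
  have hf : IsBoundedLipschitz Uad f (max Lf 0) Mf :=
    ⟨hf_cont, fun y y' u hu ↦ (hf_lip y y' u hu).trans (by gcongr; exact le_max_left _ _), hf_bdd⟩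
  have hg : IsBoundedLipschitz Uad g (max Lg 0) Mg :=
    ⟨hg_cont, fun y y' u hu ↦ (hg_lip y y' u hu).trans (by gcongr; exact le_max_left _ _), hg_bdd⟩
  have hL₀ : 0 ≤ max Lf 0 := le_max_right _ _
  have hG : 0 ≤ max Lg 0 := le_max_right _ _
  have hL₀lam : max Lf 0 < lam := max_lt ((le_max_right _ _).trans_lt hlam) hlam0
  set L₀ := max Lf 0
  set G := max Lg 0
  obtain ⟨L, hL, hLlam⟩ := exists_between hL₀lam
  have hL0 : 0 < L - L₀ := sub_pos.2 hL
  have hlamL : 0 < lam - L := sub_pos.2 hLlam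
  obtain ⟨D, hD⟩ : ∃ D : ℝ, D =
    Module.finrank ℝ (EuclideanSpace ℝ (Fin n) × ℝ) * (2 * (Mf + Mg)) + 1 := ⟨_, rfl⟩
  have hD0 : 0 ≤ D := by rw [hD]; positivity
  have hDL : 0 ≤ D * L := mul_nonneg hD0 (hL₀.trans hL.le)
  have hLM : 0 ≤ L₀ * Mf := mul_nonneg hL₀ hM
  obtain ⟨K, hK⟩ : ∃ K : ℝ, K = (D * L + L₀ * Mf) / (L - L₀) := ⟨_, rfl⟩
  have hK0 : 0 ≤ K := by rw [hK]; positivity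
  have hKL : K * (L - L₀) = D * L + L₀ * Mf := by rw [hK, div_mul_cancel₀ _ hL0.ne']
  have hDK : D * L ≤ K * (L - L₀) := by linarith
  have hMK : L₀ * Mf ≤ K * (L - L₀) := by linarith
  refine ⟨2 * G * Mf / lam + 3 * Mg + D + G * K / (lam - L), by positivity,
    fun h ⟨hh, hh'⟩ vh _ ⟨B, hB⟩ hdpe y₀ ↦ ?_⟩
  have hlh : lam * h < 1 := by rw [lt_div_iff₀ hlam0] at hh'; linarith
  have hbelow : BddBelow {c : ℝ |
      ∃ (u : ℝ → EuclideanSpace ℝ (Fin m)) (y : ℝ → EuclideanSpace ℝ (Fin n)),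
        Measurable u ∧ (∀ t, 0 ≤ t → u t ∈ Uad) ∧ Continuous y ∧
        (∀ t, 0 ≤ t → y t = y₀ + ∫ s in (0 : ℝ)..t, f (y s) (u s)) ∧
        c = ∫ t in Ici (0 : ℝ), g (y t) (u t) * exp (-lam * t)} := by
    refine ⟨-(Mg / lam), ?_⟩
    rintro _ ⟨u, y, h1, h2, h3, h4, rfl⟩
    have := IsTrajectory.abs_integral_Ioi_le hg ⟨h1, h2, h3, h4⟩ hlam0 le_rfl
    rw [mul_zero, exp_zero, one_mul, ← integral_Ici_eq_integral_Ioi] at this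
    exact (abs_le.1 this).1
  obtain ⟨u, y, hy, hcost⟩ := exists_isTrajectory_cost_le_supersolution_add hf hL₀ hL hLlam hM hK0
    hMK hg hG hMg hD0 hDK hh hlh hB
    (fun x ↦ let ⟨v, hv, hvx⟩ := (hdpe x).1; ⟨v, hv, hvx.ge⟩) y₀
  have hmem := csInf_le hbelow ⟨u, y, hy.meas, hy.mem, hy.cont, hy.eq, rfl⟩
  rw [hv y₀, abs_le]
  refine ⟨?_, by linarith⟩
  rw [neg_le_sub_iff_le_add, ← sub_le_iff_le_add]
  refine le_csInf ⟨_, u, y, hy.meas, hy.mem, hy.cont, hy.eq, rfl⟩ ?_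
  rintro _ ⟨u', y', h1, h2, h3, h4, rfl⟩
  rw [sub_le_iff_le_add]
  exact IsTrajectory.subsolution_le_cost_add hf hL₀ hL hLlam hM hK0 hMK hg hG hMg hD hDK hh hlh hB
    (fun x v hv ↦ (hdpe x).2 ⟨v, hv, rfl⟩) ⟨h1, h2, h3, h4⟩
end

section
/- Let T > 0, let M be a positive integer, Δt = T/M and t_n = n Δt for n = 0,…,M. Let X be a real normed space and let z : [0,T] → X be twice continuously differentiable. Then max_{0 ≤ k ≤ M} ‖z(t_k)‖² ≤ 3 ‖z̄‖² + (12 T²/M) Σ_{n=1}^{M} ‖z'(t_n)‖² + (16T/3) (Δt)² ∫₀^T ‖z''(s)‖² ds, where z̄ = (1/(M+1)) Σ_{j=0}^{M} z(t_j). -/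
open MeasureTheory Real Set

/-- The Cauchy–Schwarz inequality against the constant function `1`. -/
theorem sq_intervalIntegral_le_mul_intervalIntegral_sq {a b : ℝ} (hab : a < b) {g : ℝ → ℝ}
    (hg : Continuous g) :
    (∫ s in a..b, g s) ^ 2 ≤ (b - a) * ∫ s in a..b, g s ^ 2 := by
  have hba : 0 < b - a := sub_pos.2 hab
  set J := ∫ s in a..b, g s
  set c := J / (b - a) with hc
  have hnonneg : 0 ≤ ∫ s in a..b, (g s - c) ^ 2 :=
    intervalIntegral.integral_nonneg hab.le fun _ _ => sq_nonneg _
  have hexpand : ∫ s in a..b, (g s - c) ^ 2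
      = (∫ s in a..b, g s ^ 2) - 2 * c * J + (b - a) * c ^ 2 := by
    have hrw : ∀ s, (g s - c) ^ 2 = g s ^ 2 - 2 * c * g s + c ^ 2 := fun s => by ring
    simp_rw [hrw]
    rw [intervalIntegral.integral_add, intervalIntegral.integral_sub,
      intervalIntegral.integral_const_mul, intervalIntegral.integral_const, smul_eq_mul]
    all_goals exact Continuous.intervalIntegrable (by fun_prop) _ _
  have hJ : J = c * (b - a) := by rw [hc]; field_simp
  rw [hexpand] at hnonneg
  rw [hJ] at hnonneg ⊢
  nlinarith [mul_nonneg hba.le hnonneg]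

/-- Mean value inequality in terms of the derivative at the right endpoint and the integral of
the norm of the second derivative. -/
theorem norm_sub_le_mul_norm_deriv_add_integral
    {X : Type*} [NormedAddCommGroup X] [NormedSpace ℝ X] {z : ℝ → X} (hz : ContDiff ℝ 2 z)
    {a b : ℝ} (hab : a ≤ b) :
    ‖z b - z a‖ ≤ (b - a) * (‖deriv z b‖ + ∫ s in a..b, ‖deriv (deriv z) s‖) := by
  have hz' : ContDiff ℝ 1 (deriv z) := ((contDiff_succ_iff_deriv (n := 1)).1 hz).2.2
  have hg : Continuous fun s => ‖deriv (deriv z) s‖ := (hz'.continuous_deriv le_rfl).norm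
  have hd : Differentiable ℝ z := hz.differentiable two_ne_zero
  rw [mul_comm]
  refine norm_image_sub_le_of_norm_deriv_le_segment' (f' := deriv z)
    (fun x _ => (hd x).hasDerivAt.hasDerivWithinAt) (fun x hx => ?_) b (right_mem_Icc.2 hab)
  have hint : ∫ s in x..b, ‖deriv (deriv z) s‖ ≤ ∫ s in a..b, ‖deriv (deriv z) s‖ :=
    intervalIntegral.integral_mono_interval hx.1 hx.2.le le_rfl
      (Filter.Eventually.of_forall fun _ => norm_nonneg _) (hg.intervalIntegrable _ _)
  have hinc := norm_sub_le_integral_of_norm_deriv_le_of_le hx.2.le hz'.continuous.continuousOn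
    (hz'.differentiable one_ne_zero).differentiableOn
    (Filter.Eventually.of_forall fun _ _ => le_rfl) (hg.intervalIntegrable _ _)
  have htri := norm_sub_norm_le (deriv z x) (deriv z b)
  rw [norm_sub_rev] at htri
  linarith

/-- Lemma 3.1: a pointwise-in-time bound for a twice continuously differentiable
function in terms of its mean over the time grid, its first derivatives at the grid
points and the `L²` norm of its second derivative. -/
theorem max_grid_bound_by_mean_and_derivatives
    {X : Type*} [NormedAddCommGroup X] [NormedSpace ℝ X]
    (T : ℝ) (hT : 0 < T) (M : ℕ) (hM : 0 < M)
    (z : ℝ → X) (hz : ContDiff ℝ 2 z)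
    (zbar : X) (hzbar : zbar = (M + 1 : ℝ)⁻¹ • ∑ j ∈ Finset.range (M + 1), z (j * (T / M))) :
    ∀ k ≤ M, ‖z (k * (T / M))‖ ^ 2 ≤
      3 * ‖zbar‖ ^ 2 + (12 * T ^ 2 / M) * ∑ n ∈ Finset.Icc 1 M, ‖deriv z (n * (T / M))‖ ^ 2
        + (16 * T / 3) * (T / M) ^ 2 * ∫ s in Icc (0 : ℝ) T, ‖deriv (deriv z) s‖ ^ 2 := by
  intro k hk
  set h : ℝ := T / M with hh
  have hM' : (0 : ℝ) < M := by exact_mod_cast hM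
  have hpos : 0 < h := div_pos hT hM'
  have hMh : (M : ℝ) * h = T := by rw [hh]; field_simp
  have hz'' : Continuous (deriv (deriv z)) :=
    ((contDiff_succ_iff_deriv (n := 1)).1 hz).2.2.continuous_deriv le_rfl
  have hg : Continuous fun s => ‖deriv (deriv z) s‖ := hz''.norm
  rw [integral_Icc_eq_integral_Ioc, ← intervalIntegral.integral_of_le hT.le]
  set I : ℝ := ∫ s in (0 : ℝ)..T, ‖deriv (deriv z) s‖ ^ 2 with hI
  set J : ℝ := ∫ s in (0 : ℝ)..T, ‖deriv (deriv z) s‖ with hJ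
  set D : ℝ := ∑ n ∈ Finset.Icc 1 M, ‖deriv z (n * h)‖ with hD
  set S : ℝ := ∑ n ∈ Finset.Icc 1 M, ‖deriv z (n * h)‖ ^ 2 with hS
  have hJI : J ^ 2 ≤ T * I := by
    simpa using sq_intervalIntegral_le_mul_intervalIntegral_sq hT hg
  have hDS : D ^ 2 ≤ M * S := by
    simpa using sq_sum_le_card_mul_sum_sq (s := Finset.Icc 1 M) (f := fun n : ℕ => ‖deriv z (n * h)‖)
  have hsum : ∑ i ∈ Finset.range M, dist (z (i * h)) (z ((i + 1 : ℕ) * h)) ≤ h * D + h * J := by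
    have hstep : ∀ i ∈ Finset.range M, dist (z (i * h)) (z ((i + 1 : ℕ) * h)) ≤
        h * ‖deriv z ((i + 1 : ℕ) * h)‖
          + h * ∫ s in (i * h : ℝ)..((i + 1 : ℕ) * h), ‖deriv (deriv z) s‖ := by
      intro i _
      have hsub : ((i + 1 : ℕ) : ℝ) * h - i * h = h := by push_cast; ring
      have := norm_sub_le_mul_norm_deriv_add_integral hz (a := i * h) (b := (i + 1 : ℕ) * h)
        (by linarith)
      rw [hsub] at this
      rw [dist_comm, dist_eq_norm]
      linarith
    refine (Finset.sum_le_sum hstep).trans_eq ?_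
    rw [Finset.sum_add_distrib, ← Finset.mul_sum, ← Finset.mul_sum,
      intervalIntegral.sum_integral_adjacent_intervals (a := fun i : ℕ => (i : ℝ) * h)
        fun _ _ => hg.intervalIntegrable _ _, hMh, hD,
      ← Finset.Ico_add_one_right_eq_Icc, ← Finset.sum_Ico_add' _ 0 M 1]
    simp [hJ]
  have hdist : ∀ i j : ℕ, i ≤ j → j ≤ M → dist (z (i * h)) (z (j * h)) ≤ h * D + h * J := by
    intro i j hij hj
    refine (dist_le_Ico_sum_dist (fun n : ℕ => z (n * h)) hij).trans (le_trans ?_ hsum)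
    refine Finset.sum_le_sum_of_subset_of_nonneg ?_ fun _ _ _ => dist_nonneg
    intro n hn
    simp only [Finset.mem_Ico, Finset.mem_range] at hn ⊢
    omega
  have hmean : ‖z (k * h) - zbar‖ ≤ h * D + h * J := by
    have hmem := (convex_closedBall (z (k * h)) (h * D + h * J)).sum_mem
      (t := Finset.range (M + 1)) (w := fun _ => (M + 1 : ℝ)⁻¹) (z := fun j : ℕ => z (j * h))
      (fun _ _ => by positivity)
      (by rw [Finset.sum_const, Finset.card_range, nsmul_eq_mul]; push_cast; field_simp)
      (fun j hj => by
        have hj' : j ≤ M := Nat.lt_succ_iff.1 (Finset.mem_range.1 hj)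
        rw [Metric.mem_closedBall]
        rcases le_total j k with hjk | hjk
        · exact hdist j k hjk hk
        · rw [dist_comm]; exact hdist k j hjk hj')
    rw [← Finset.smul_sum, ← hzbar, Metric.mem_closedBall, dist_comm, dist_eq_norm] at hmem
    exact hmem
  have hnorm : ‖z (k * h)‖ ≤ ‖zbar‖ + h * D + h * J := by
    linarith [norm_sub_norm_le (z (k * h)) zbar]
  have hI0 : 0 ≤ I := intervalIntegral.integral_nonneg hT.le fun _ _ => by positivity
  have hS0 : 0 ≤ S := Finset.sum_nonneg fun _ _ => by positivity
  have hcoef : 12 * T ^ 2 / M * S = 12 * (h ^ 2 * (M * S)) := by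
    rw [← hMh]; field_simp
  rw [hcoef]
  calc ‖z (k * h)‖ ^ 2 ≤ (‖zbar‖ + h * D + h * J) ^ 2 := by gcongr
    _ ≤ 3 * ‖zbar‖ ^ 2 + 3 * (h ^ 2 * D ^ 2) + 3 * (h ^ 2 * J ^ 2) := by
      nlinarith [sq_nonneg (‖zbar‖ - h * D), sq_nonneg (‖zbar‖ - h * J),
        sq_nonneg (h * D - h * J)]
    _ ≤ 3 * ‖zbar‖ ^ 2 + 3 * (h ^ 2 * (M * S)) + 3 * (h ^ 2 * (T * I)) := by gcongr
    _ ≤ _ := by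
      have h1 : 0 ≤ h ^ 2 * (M * S) := by positivity
      have h2 : 0 ≤ h ^ 2 * (T * I) := by positivity
      linarith
end

section
/- Let X be a real inner product space and w_1,…,w_m ∈ X. Let K ∈ ℝ^{m×m} be the symmetric positive semidefinite matrix with entries K_{ij} = (1/m)(w_i, w_j), let λ_1 ≥ λ_2 ≥ … ≥ λ_m ≥ 0 be all its eigenvalues listed with multiplicity, with a corresponding Euclidean-orthonormal basis of eigenvectors v_1,…,v_m of ℝ^m, and let d be the number of strictly positive eigenvalues. For 1 ≤ k ≤ d define the POD basis vectors φ_k = (1/(√m √λ_k)) Σ_{j=1}^{m} v_k^j w_j. Then for every 1 ≤ r ≤ d: (1/m) Σ_{j=1}^{m} ‖w_j − Σ_{k=1}^{r} (w_j, φ_k) φ_k‖² = Σ_{k=r+1}^{d} λ_k. -/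
open scoped RealInnerProductSpace

/-- Bessel's identity for the residual of a projection onto a finite orthonormal family. -/
theorem norm_sub_sum_inner_smul_sq {X ι : Type*} [NormedAddCommGroup X] [InnerProductSpace ℝ X]
    [DecidableEq ι] (S : Finset ι) (φ : ι → X)
    (h : ∀ k ∈ S, ∀ l ∈ S, ⟪φ k, φ l⟫ = if k = l then (1 : ℝ) else 0) (x : X) :
    ‖x - ∑ k ∈ S, ⟪x, φ k⟫ • φ k‖ ^ 2 = ‖x‖ ^ 2 - ∑ k ∈ S, ⟪x, φ k⟫ ^ 2 := by
  have hcross : ⟪x, ∑ k ∈ S, ⟪x, φ k⟫ • φ k⟫ = ∑ k ∈ S, ⟪x, φ k⟫ ^ 2 := by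
    simp only [inner_sum, inner_smul_right, sq]
  have hself : ‖∑ k ∈ S, ⟪x, φ k⟫ • φ k‖ ^ 2 = ∑ k ∈ S, ⟪x, φ k⟫ ^ 2 := by
    rw [← real_inner_self_eq_norm_sq, sum_inner]
    refine Finset.sum_congr rfl fun k hk => ?_
    rw [inner_sum, Finset.sum_eq_single_of_mem k hk]
    · rw [real_inner_smul_left, real_inner_smul_right, h k hk k hk, if_pos rfl]
      ring
    · intro l hl hlk
      rw [real_inner_smul_left, real_inner_smul_right, h k hk l hl, if_neg hlk.symm]
      ring
  rw [norm_sub_sq_real, hcross, hself]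
  ring

/-- The trace of a real matrix with an orthonormal eigenbasis is the sum of its eigenvalues. -/
theorem Matrix.trace_eq_sum_of_orthonormal_eigenbasis {n : Type*} [Fintype n] [DecidableEq n]
    (K : Matrix n n ℝ) (lam : n → ℝ) (v : n → n → ℝ)
    (heig : ∀ k, K.mulVec (v k) = lam k • v k)
    (horth : ∀ k l, (∑ j, v k j * v l j) = if k = l then (1 : ℝ) else 0) :
    K.trace = ∑ k, lam k := by
  have hV : Matrix.of v * (Matrix.of v).transpose = 1 := by
    ext k l
    simp [Matrix.mul_apply, Matrix.one_apply, horth]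
  have hKV : K * (Matrix.of v).transpose = (Matrix.of v).transpose * Matrix.diagonal lam := by
    ext i k
    rw [Matrix.mul_diagonal]
    simpa [Matrix.mulVec, dotProduct, Matrix.mul_apply, mul_comm] using congrFun (heig k) i
  rw [← Matrix.trace_diagonal, ← Matrix.one_mul (Matrix.diagonal lam), ← hV, Matrix.mul_assoc,
    ← hKV, Matrix.trace_mul_comm, Matrix.mul_assoc, mul_eq_one_comm.mp hV, Matrix.mul_one]

/-- The POD projection-error formula: the mean squared error of projecting the
snapshots onto the span of the first `r` POD basis vectors equals the tail
`Σ_{k=r+1}^{d} λ_k` of the eigenvalues of the correlation matrix.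
(Eigenvalues are indexed here by `Fin m`, 0-based, sorted in decreasing order;
`d` is the number of strictly positive ones.) -/
theorem pod_projection_error
    {X : Type*} [NormedAddCommGroup X] [InnerProductSpace ℝ X]
    (m : ℕ) (hm : 0 < m) (w : Fin m → X)
    (K : Matrix (Fin m) (Fin m) ℝ)
    (hK : ∀ i j, K i j = (1 / (m : ℝ)) * ⟪w i, w j⟫)
    (lam : Fin m → ℝ) (v : Fin m → (Fin m → ℝ))
    (hsort : ∀ i j : Fin m, i ≤ j → lam j ≤ lam i)
    (hnonneg : ∀ k, 0 ≤ lam k)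
    (heig : ∀ k, K.mulVec (v k) = lam k • v k)
    (horth : ∀ k l, (∑ j, v k j * v l j) = if k = l then (1 : ℝ) else 0)
    (d : ℕ) (hd : d ≤ m)
    (hdpos : ∀ k : Fin m, (k : ℕ) < d ↔ 0 < lam k)
    (φ : Fin m → X)
    (hφ : ∀ k : Fin m, (k : ℕ) < d →
      φ k = (1 / (Real.sqrt m * Real.sqrt (lam k))) • ∑ j, v k j • w j) :
    ∀ r, 1 ≤ r → r ≤ d →
      (1 / (m : ℝ)) * ∑ j, ‖w j - ∑ k ∈ Finset.univ.filter (fun k : Fin m => (k : ℕ) < r),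
          ⟪w j, φ k⟫ • φ k‖ ^ 2
        = ∑ k ∈ Finset.univ.filter (fun k : Fin m => r ≤ (k : ℕ) ∧ (k : ℕ) < d), lam k := by
  intro r _ hrd
  have hm0 : (0 : ℝ) < m := Nat.cast_pos.mpr hm
  have hsm : √(m : ℝ) ≠ 0 := (Real.sqrt_pos.mpr hm0).ne'
  have hinner : ∀ k : Fin m, (k : ℕ) < d → ∀ j, ⟪w j, φ k⟫ = √m * √(lam k) * v k j := by
    intro k hk j
    have hl := (hdpos k).mp hk
    have hsl : √(lam k) ≠ 0 := (Real.sqrt_pos.mpr hl).ne'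
    have hgram : ∑ i, v k i * ⟪w j, w i⟫ = m * (lam k * v k j) := by
      have h := congrFun (heig k) j
      simp only [Matrix.mulVec, dotProduct, hK, Pi.smul_apply, smul_eq_mul] at h
      rw [← h, Finset.mul_sum]
      refine Finset.sum_congr rfl fun i _ => ?_
      field_simp
    rw [hφ k hk, real_inner_smul_right, inner_sum]
    simp only [real_inner_smul_right]
    rw [hgram]
    field_simp
    rw [Real.sq_sqrt hm0.le, Real.sq_sqrt hl.le]
  have horthφ : ∀ k : Fin m, (k : ℕ) < d → ∀ l : Fin m, (l : ℕ) < d →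
      ⟪φ k, φ l⟫ = if k = l then (1 : ℝ) else 0 := by
    intro k hk l hl
    have hsl : √(lam k) ≠ 0 := (Real.sqrt_pos.mpr ((hdpos k).mp hk)).ne'
    have hsum : ∑ j, v k j * (√m * √(lam l) * v l j) =
        √m * √(lam l) * if k = l then (1 : ℝ) else 0 := by
      rw [← horth, Finset.mul_sum]
      exact Finset.sum_congr rfl fun j _ => by ring
    rw [hφ k hk, real_inner_smul_left, sum_inner]
    simp only [real_inner_smul_left, hinner l hl]
    rw [hsum]
    split_ifs with hkl
    · subst hkl
      field_simp
    · simp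
  have htrace : ∑ j, ‖w j‖ ^ 2 = m * ∑ k, lam k := by
    rw [← Matrix.trace_eq_sum_of_orthonormal_eigenbasis K lam v heig horth, Matrix.trace,
      Finset.mul_sum]
    refine Finset.sum_congr rfl fun j _ => ?_
    rw [Matrix.diag_apply, hK, real_inner_self_eq_norm_sq]
    field_simp
  have hcoeff : ∀ k : Fin m, (k : ℕ) < d → ∑ j, ⟪w j, φ k⟫ ^ 2 = m * lam k := by
    intro k hk
    have h := horth k k
    rw [if_pos rfl] at h
    rw [← mul_one (m * lam k), ← h, Finset.mul_sum]
    refine Finset.sum_congr rfl fun j _ => ?_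
    rw [hinner k hk, mul_pow, mul_pow, Real.sq_sqrt hm0.le, Real.sq_sqrt (hnonneg k)]
    ring
  have hlt : ∀ k ∈ Finset.univ.filter (fun k : Fin m => (k : ℕ) < r), (k : ℕ) < d :=
    fun k hk => (Finset.mem_filter.mp hk).2.trans_le hrd
  have htail : ∑ k ∈ Finset.univ.filter (fun k : Fin m => r ≤ (k : ℕ) ∧ (k : ℕ) < d), lam k =
      ∑ k ∈ Finset.univ.filter (fun k : Fin m => ¬ (k : ℕ) < r), lam k := by
    refine Finset.sum_subset (fun k hk => ?_) fun k hk hk' => ?_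
    · simp only [Finset.mem_filter, Finset.mem_univ, true_and] at hk ⊢
      exact not_lt.mpr hk.1
    · simp only [Finset.mem_filter, Finset.mem_univ, true_and, not_and, not_lt] at hk hk'
      exact le_antisymm (not_lt.mp fun h => (hk' hk).not_gt ((hdpos k).mpr h)) (hnonneg k)
  rw [Finset.sum_congr rfl fun j _ => norm_sub_sum_inner_smul_sq _ φ
      (fun k hk l hl => horthφ k (hlt k hk) l (hlt l hl)) (w j),
    Finset.sum_sub_distrib, Finset.sum_comm, htrace,
    Finset.sum_congr rfl fun k hk => hcoeff k (hlt k hk), ← Finset.mul_sum, htail,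
    ← Finset.sum_filter_add_sum_filter_not Finset.univ (fun k : Fin m => (k : ℕ) < r) lam]
  field_simp
  ring
end

section
/- Assume λ > L_f. Fix y ∈ ℝⁿ and assume there exist admissible controls u and u^r attaining the infima defining v(P^r y) and v^r(P_c^r y) respectively, and let y(·) be the trajectory of the full system with initial state P^r y and control u, and y_r(·) the trajectory of the full system with initial state P^r y and control u^r. Then |v(P^r y) − v^r(P_c^r y)| ≤ L_g ∫₀^∞ t e^{(L_f − λ)t} sup_{0 ≤ s ≤ t} ‖f(y(s),u(s)) − P^r f(y(s),u(s))‖ dt + L_g ∫₀^∞ t e^{(L_f − λ)t} sup_{0 ≤ s ≤ t} ‖f(y_r(s),u^r(s)) − P^r f(y_r(s),u^r(s))‖ dt. -/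
open MeasureTheory Real Set
open scoped RealInnerProductSpace

/-- Grönwall's inequality in integral form, with a constant forcing term. -/
theorem le_mul_exp_of_le_add_mul_integral {e : ℝ → ℝ} (he : Continuous e) {a L T : ℝ}
    (hL : 0 ≤ L) (hT : 0 ≤ T)
    (h : ∀ t ∈ Icc 0 T, e t ≤ a + L * ∫ s in (0 : ℝ)..t, e s) :
    e T ≤ a * exp (L * T) := by
  have hd : ∀ t, HasDerivAt (fun t => exp (-(L * t)) * (a + L * ∫ s in (0 : ℝ)..t, e s))
      (exp (-(L * t)) * (L * (e t - (a + L * ∫ s in (0 : ℝ)..t, e s)))) t := by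
    intro t
    have h1 : HasDerivAt (fun t => ∫ s in (0 : ℝ)..t, e s) (e t) t :=
      intervalIntegral.integral_hasDerivAt_right (he.intervalIntegrable _ _)
        (he.stronglyMeasurableAtFilter _ _) he.continuousAt
    have h2 : HasDerivAt (fun t => exp (-(L * t))) (exp (-(L * t)) * (-(L * 1))) t :=
      (((hasDerivAt_id t).const_mul L).neg).exp
    refine (h2.mul ((h1.const_mul L).const_add a)).congr_deriv ?_
    ring
  have hanti := antitoneOn_of_deriv_nonpos (convex_Icc 0 T)
    (fun t _ => (hd t).continuousAt.continuousWithinAt)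
    (fun t _ => (hd t).differentiableAt.differentiableWithinAt)
    (fun t ht => by
      rw [(hd t).deriv]
      have := h t (interior_subset ht)
      exact mul_nonpos_of_nonneg_of_nonpos (exp_pos _).le
        (mul_nonpos_of_nonneg_of_nonpos hL (by linarith)))
  have h0 := hanti ⟨le_rfl, hT⟩ ⟨hT, le_rfl⟩ hT
  simp only [mul_zero, neg_zero, exp_zero, one_mul, intervalIntegral.integral_same,
    add_zero, exp_neg] at h0
  have hpos := exp_pos (L * T)
  rw [inv_mul_le_iff₀ hpos] at h0
  have := h T ⟨hT, le_rfl⟩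
  linarith

theorem intervalIntegrable_of_norm_le_s8 {E : Type*} [NormedAddCommGroup E] {w : ℝ → E} {M : ℝ}
    (hw : AEStronglyMeasurable w) (hM : ∀ s, 0 ≤ s → ‖w s‖ ≤ M) {a b : ℝ} (ha : 0 ≤ a)
    (hb : 0 ≤ b) : IntervalIntegrable w volume a b := by
  refine (intervalIntegrable_const (c := M)).mono_fun' hw.restrict ?_
  filter_upwards [ae_restrict_mem measurableSet_uIoc] with s hs
  exact hM s ((le_min ha hb).trans hs.1.le)

/-- Global existence for a Carathéodory differential equation in integral form, with bounded
right-hand side that is Lipschitz in the state. -/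
theorem exists_continuous_integral_solution {E : Type*} [NormedAddCommGroup E] [NormedSpace ℝ E]
    [CompleteSpace E] {F : ℝ → E → E} {L M : ℝ} (hL : 0 ≤ L)
    (hmeas : ∀ w : ℝ → E, Continuous w → AEStronglyMeasurable (fun s => F s (w s)))
    (hbdd : ∀ s, 0 ≤ s → ∀ x, ‖F s x‖ ≤ M)
    (hlip : ∀ s, 0 ≤ s → ∀ x x', ‖F s x - F s x'‖ ≤ L * ‖x - x'‖) (z : E) :
    ∃ y : ℝ → E, Continuous y ∧
      ∀ t, 0 ≤ t → y t = z + ∫ s in (0 : ℝ)..t, F s (y s) := by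
  have hM : 0 ≤ M := (norm_nonneg _).trans (hbdd 0 le_rfl 0)
  set K := L + 1 with hK
  have hKpos : 0 < K := by positivity
  let path : BoundedContinuousFunction ℝ E → ℝ → E := fun w s => z + exp (K * s) • w s
  have hpath : ∀ w, Continuous (path w) := fun w => by
    have := w.continuous
    fun_prop
  have hint : ∀ w a b, 0 ≤ a → 0 ≤ b →
      IntervalIntegrable (fun s => F s (path w s)) volume a b := fun w a b ha hb =>
    intervalIntegrable_of_norm_le_s8 (hmeas _ (hpath w)) (fun s hs => hbdd s hs _) ha hb
  have hprim : ∀ w, Continuous fun t : ℝ => ∫ s in (0 : ℝ)..max t 0, F s (path w s) := by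
    intro w
    refine (LipschitzWith.of_dist_le_mul (K := M.toNNReal) fun t t' => ?_).continuous
    rw [Real.coe_toNNReal _ hM, dist_eq_norm, intervalIntegral.integral_interval_sub_left
      (hint w _ _ le_rfl (le_max_right _ _)) (hint w _ _ le_rfl (le_max_right _ _))]
    refine (intervalIntegral.norm_integral_le_of_norm_le_const (C := M) fun s hs =>
      hbdd s ((le_min (le_max_right _ _) (le_max_right _ _)).trans hs.1.le) _).trans ?_
    refine mul_le_mul_of_nonneg_left ?_ hM
    rw [Real.dist_eq]
    exact abs_max_sub_max_le_abs _ _ _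
  let T : BoundedContinuousFunction ℝ E → BoundedContinuousFunction ℝ E := fun w =>
    BoundedContinuousFunction.ofNormedAddCommGroup
      (fun t => exp (-(K * max t 0)) • ∫ s in (0 : ℝ)..max t 0, F s (path w s))
      ((by fun_prop : Continuous fun t : ℝ => exp (-(K * max t 0))).smul (hprim w)) (M / K) (by
        intro t
        have ht : 0 ≤ max t 0 := le_max_right _ _
        have h1 : ‖∫ s in (0 : ℝ)..max t 0, F s (path w s)‖ ≤ M * |max t 0 - 0| :=
          intervalIntegral.norm_integral_le_of_norm_le_const fun s hs =>
            hbdd s ((le_min le_rfl ht).trans hs.1.le) _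
        rw [sub_zero, abs_of_nonneg ht] at h1
        rw [norm_smul, Real.norm_eq_abs, abs_of_pos (exp_pos _), exp_neg,
          inv_mul_le_iff₀ (exp_pos _)]
        refine h1.trans ?_
        rw [mul_div_assoc', le_div_iff₀ hKpos]
        have := add_one_le_exp (K * max t 0)
        nlinarith)
  have hT : ContractingWith (L / K).toNNReal T := by
    refine ⟨?_, LipschitzWith.of_dist_le_mul fun w w' => ?_⟩
    · rw [Real.toNNReal_lt_one, div_lt_one hKpos]
      linarith
    · rw [Real.coe_toNNReal _ (by positivity), BoundedContinuousFunction.dist_le (by positivity)]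
      intro t
      have ht : 0 ≤ max t 0 := le_max_right _ _
      change dist (exp (-(K * max t 0)) • ∫ s in (0 : ℝ)..max t 0, F s (path w s))
        (exp (-(K * max t 0)) • ∫ s in (0 : ℝ)..max t 0, F s (path w' s)) ≤ _
      rw [dist_eq_norm, ← smul_sub, norm_smul, Real.norm_eq_abs, abs_of_pos (exp_pos _), exp_neg,
        inv_mul_le_iff₀ (exp_pos _), ← intervalIntegral.integral_sub
          (hint w _ _ le_rfl ht) (hint w' _ _ le_rfl ht)]
      have h1 : ‖∫ s in (0 : ℝ)..max t 0, (F s (path w s) - F s (path w' s))‖ ≤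
          ∫ s in (0 : ℝ)..max t 0, L * dist w w' * exp (K * s) := by
        refine intervalIntegral.norm_integral_le_of_norm_le ht ?_
          ((by fun_prop : Continuous fun s : ℝ => L * dist w w' * exp (K * s)).intervalIntegrable
            _ _)
        filter_upwards with s hs
        refine (hlip s hs.1.le _ _).trans ?_
        have h2 : path w s - path w' s = exp (K * s) • (w s - w' s) := by
          simp only [path, smul_sub]
          abel
        rw [h2, norm_smul, Real.norm_eq_abs, abs_of_pos (exp_pos _), ← dist_eq_norm, mul_assoc]
        have h3 := w.dist_coe_le_dist (g := w') s
        have h4 := mul_le_mul_of_nonneg_left h3 (exp_pos (K * s)).le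
        rw [mul_comm (dist w w')]
        exact mul_le_mul_of_nonneg_left h4 hL
      refine h1.trans ?_
      rw [intervalIntegral.integral_const_mul,
        intervalIntegral.integral_comp_mul_left (fun x => exp x) hKpos.ne', integral_exp, smul_eq_mul]
      have h5 : (0 : ℝ) ≤ L * dist w w' / K := by positivity
      have h6 : exp (K * 0) = 1 := by simp
      rw [h6]
      calc L * dist w w' * (K⁻¹ * (exp (K * max t 0) - 1))
          = L * dist w w' / K * (exp (K * max t 0) - 1) := by ring
        _ ≤ L * dist w w' / K * exp (K * max t 0) :=
          mul_le_mul_of_nonneg_left (by linarith) h5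
        _ = _ := by ring
  obtain ⟨w, hw⟩ : ∃ w, T w = w := ⟨_, hT.fixedPoint_isFixedPt⟩
  refine ⟨path w, hpath w, fun t ht => ?_⟩
  have h1 : w t = exp (-(K * max t 0)) • ∫ s in (0 : ℝ)..max t 0, F s (path w s) :=
    (DFunLike.congr_fun hw t).symm
  rw [max_eq_left ht] at h1
  change z + exp (K * t) • w t = _
  rw [h1, smul_smul, ← exp_add, add_neg_cancel, exp_zero, one_smul]

theorem monotoneOn_iSup_Icc {ρ : ℝ → ℝ} {M : ℝ} (hρ : ∀ s, 0 ≤ s → ρ s ≤ M) :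
    MonotoneOn (fun t => ⨆ s : Icc (0 : ℝ) t, ρ s.1) (Ici 0) := by
  intro a ha b _ hab
  have : Nonempty (Icc (0 : ℝ) a) := ⟨⟨0, le_rfl, ha⟩⟩
  exact ciSup_le fun s => le_ciSup (f := fun s : Icc (0 : ℝ) b => ρ s.1)
    ⟨M, by rintro _ ⟨s, rfl⟩; exact hρ _ s.2.1⟩ ⟨s.1, s.2.1, s.2.2.trans hab⟩

theorem integrableOn_mul_exp_mul_iSup_Icc {ρ : ℝ → ℝ} {M c : ℝ} (hc : c < 0)
    (h0 : ∀ s, 0 ≤ ρ s) (hρ : ∀ s, 0 ≤ s → ρ s ≤ M) :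
    IntegrableOn (fun t => t * exp (c * t) * ⨆ s : Icc (0 : ℝ) t, ρ s.1) (Ici 0) := by
  have h1 : IntegrableOn (fun t : ℝ => t * exp (c * t)) (Ici 0) := by
    rw [integrableOn_Ici_iff_integrableOn_Ioi]
    have := integrableOn_rpow_mul_exp_neg_mul_rpow (p := 1) (s := 1) (b := -c) (by norm_num)
      (by norm_num) (by linarith)
    simpa using this
  refine Integrable.mul_bdd (c := M) h1
    (aemeasurable_restrict_of_monotoneOn measurableSet_Ici
      (monotoneOn_iSup_Icc hρ)).aestronglyMeasurable ?_
  filter_upwards [ae_restrict_mem measurableSet_Ici] with t ht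
  have : Nonempty (Icc (0 : ℝ) t) := ⟨⟨0, le_rfl, ht⟩⟩
  rw [Real.norm_eq_abs, abs_of_nonneg (Real.iSup_nonneg fun s => h0 _)]
  exact ciSup_le fun s => hρ _ s.2.1

section Discounted

variable {h : ℝ → ℝ} {M lam : ℝ}

theorem integrableOn_exp_neg_mul_Ici (hlam : 0 < lam) :
    IntegrableOn (fun t : ℝ => exp (-lam * t)) (Ici 0) := by
  rw [integrableOn_Ici_iff_integrableOn_Ioi]
  exact integrableOn_exp_mul_Ioi (by linarith) 0

theorem integrableOn_mul_exp_neg_mul_Ici (hlam : 0 < lam) (hm : AEStronglyMeasurable h)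
    (hM : ∀ t, 0 ≤ t → |h t| ≤ M) :
    IntegrableOn (fun t => h t * exp (-lam * t)) (Ici 0) := by
  refine Integrable.bdd_mul (c := M) (integrableOn_exp_neg_mul_Ici hlam) hm.restrict ?_
  filter_upwards [ae_restrict_mem measurableSet_Ici] with t ht
  exact hM t ht

theorem abs_setIntegral_mul_exp_le (hlam : 0 < lam) (hM : ∀ t, 0 ≤ t → |h t| ≤ M) :
    |∫ t in Ici (0 : ℝ), h t * exp (-lam * t)| ≤
      ∫ t in Ici (0 : ℝ), M * exp (-lam * t) := by
  rw [← Real.norm_eq_abs]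
  refine norm_integral_le_of_norm_le ((integrableOn_exp_neg_mul_Ici hlam).const_mul M) ?_
  filter_upwards [ae_restrict_mem measurableSet_Ici] with t ht
  rw [norm_mul, Real.norm_eq_abs, Real.norm_eq_abs, abs_of_pos (exp_pos _)]
  exact mul_le_mul_of_nonneg_right (hM t ht) (exp_pos _).le

end Discounted

section Reduction

variable {E E' : Type*} [NormedAddCommGroup E] [NormedSpace ℝ E] [CompleteSpace E]
  [NormedAddCommGroup E'] [NormedSpace ℝ E'] [CompleteSpace E']
  {A : E' →L[ℝ] E} {B : E →L[ℝ] E'} {F : ℝ → E → E} {L M : ℝ} {z : E'} {y : ℝ → E} {yr : ℝ → E'}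

/-- Distance between a trajectory and the lift of the reduced trajectory with the same initial
state, in terms of the projection error along the former. -/
theorem norm_trajectory_sub_lift_le (hA : ∀ x, ‖A x‖ ≤ ‖x‖) (hB : ∀ x, ‖B x‖ ≤ ‖x‖) (hL : 0 ≤ L)
    (hmeas : ∀ w : ℝ → E, Continuous w → AEStronglyMeasurable (fun s => F s (w s)))
    (hbdd : ∀ s, 0 ≤ s → ∀ x, ‖F s x‖ ≤ M)
    (hlip : ∀ s, 0 ≤ s → ∀ x x', ‖F s x - F s x'‖ ≤ L * ‖x - x'‖)
    (hyc : Continuous y) (hy : ∀ t, 0 ≤ t → y t = A z + ∫ s in (0 : ℝ)..t, F s (y s))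
    (hyrc : Continuous yr)
    (hyr : ∀ t, 0 ≤ t → yr t = z + ∫ s in (0 : ℝ)..t, B (F s (A (yr s))))
    {T : ℝ} (hT : 0 ≤ T) :
    ‖y T - A (yr T)‖ ≤
      T * exp (L * T) * ⨆ s : Icc (0 : ℝ) T, ‖F s.1 (y s.1) - A (B (F s.1 (y s.1)))‖ := by
  set S := ⨆ s : Icc (0 : ℝ) T, ‖F s.1 (y s.1) - A (B (F s.1 (y s.1)))‖ with hS
  have hS0 : 0 ≤ S := Real.iSup_nonneg fun _ => norm_nonneg _
  have hle : ∀ s ∈ Icc (0 : ℝ) T, ‖F s (y s) - A (B (F s (y s)))‖ ≤ S := fun s hs =>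
    le_ciSup (f := fun s : Icc (0 : ℝ) T => ‖F s.1 (y s.1) - A (B (F s.1 (y s.1)))‖)
      ⟨M + M, by
        rintro _ ⟨s, rfl⟩
        have h1 := hbdd s.1 s.2.1 (y s.1)
        exact (norm_sub_le _ _).trans (add_le_add h1 ((hA _).trans ((hB _).trans h1)))⟩ ⟨s, hs⟩
  have hec : Continuous fun t => ‖y t - A (yr t)‖ := by fun_prop
  have key := le_mul_exp_of_le_add_mul_integral hec (a := T * S) hL hT ?_
  · exact key.trans_eq (by ring)
  intro t ht
  have i1 : IntervalIntegrable (fun s => F s (y s)) volume 0 t :=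
    intervalIntegrable_of_norm_le_s8 (hmeas _ hyc) (fun s hs => hbdd s hs _) le_rfl ht.1
  have i2 : IntervalIntegrable (fun s => F s (A (yr s))) volume 0 t :=
    intervalIntegrable_of_norm_le_s8 (hmeas _ (by fun_prop)) (fun s hs => hbdd s hs _) le_rfl ht.1
  have i3 : IntervalIntegrable (fun s => B (F s (A (yr s)))) volume 0 t :=
    ⟨B.integrable_comp i2.1, B.integrable_comp i2.2⟩
  have i4 : IntervalIntegrable (fun s => A (B (F s (A (yr s))))) volume 0 t :=
    ⟨A.integrable_comp i3.1, A.integrable_comp i3.2⟩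
  have heq : y t - A (yr t) = ∫ s in (0 : ℝ)..t, (F s (y s) - A (B (F s (A (yr s))))) := by
    rw [intervalIntegral.integral_sub i1 i4, A.intervalIntegral_comp_comm i3, hy t ht.1,
      hyr t ht.1, map_add]
    abel
  have hbound : ‖y t - A (yr t)‖ ≤
      ∫ s in (0 : ℝ)..t, (S + L * ‖y s - A (yr s)‖) := by
    nth_rewrite 1 [heq]
    refine intervalIntegral.norm_integral_le_of_norm_le ht.1 ?_
      ((by fun_prop : Continuous fun s => S + L * ‖y s - A (yr s)‖).intervalIntegrable _ _)
    filter_upwards with s hs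
    have h1 : F s (y s) - A (B (F s (A (yr s)))) =
        (F s (y s) - A (B (F s (y s)))) + A (B (F s (y s) - F s (A (yr s)))) := by
      simp only [map_sub]
      abel
    rw [h1]
    exact (norm_add_le _ _).trans (add_le_add (hle s ⟨hs.1.le, hs.2.trans ht.2⟩)
      ((hA _).trans ((hB _).trans (hlip s hs.1.le _ _))))
  refine hbound.trans ?_
  rw [intervalIntegral.integral_add intervalIntegrable_const
    ((hec.const_mul L).intervalIntegrable _ _), intervalIntegral.integral_const,
    intervalIntegral.integral_const_mul, sub_zero, smul_eq_mul]
  have := mul_le_mul_of_nonneg_right ht.2 hS0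
  linarith

/-- Difference of the discounted costs along a trajectory and the lift of the reduced one. -/
theorem abs_cost_sub_reduced_cost_le {G : ℝ → E → ℝ} {Lg Mg lam : ℝ}
    (hA : ∀ x, ‖A x‖ ≤ ‖x‖) (hB : ∀ x, ‖B x‖ ≤ ‖x‖)
    (hmeas : ∀ w : ℝ → E, Continuous w → AEStronglyMeasurable (fun s => F s (w s)))
    (hbdd : ∀ s, 0 ≤ s → ∀ x, ‖F s x‖ ≤ M)
    (hlip : ∀ s, 0 ≤ s → ∀ x x', ‖F s x - F s x'‖ ≤ L * ‖x - x'‖)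
    (hGmeas : ∀ w : ℝ → E, Continuous w → AEStronglyMeasurable (fun s => G s (w s)))
    (hGbdd : ∀ s, 0 ≤ s → ∀ x, |G s x| ≤ Mg)
    (hGlip : ∀ s, 0 ≤ s → ∀ x x', |G s x - G s x'| ≤ Lg * ‖x - x'‖)
    (hlam : L < lam) (hlam0 : 0 < lam)
    (hyc : Continuous y) (hy : ∀ t, 0 ≤ t → y t = A z + ∫ s in (0 : ℝ)..t, F s (y s))
    (hyrc : Continuous yr)
    (hyr : ∀ t, 0 ≤ t → yr t = z + ∫ s in (0 : ℝ)..t, B (F s (A (yr s)))) :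
    |(∫ t in Ici (0 : ℝ), G t (y t) * exp (-lam * t)) -
        ∫ t in Ici (0 : ℝ), G t (A (yr t)) * exp (-lam * t)| ≤
      Lg * ∫ t in Ici (0 : ℝ), t * exp ((L - lam) * t) *
        ⨆ s : Icc (0 : ℝ) t, ‖F s.1 (y s.1) - A (B (F s.1 (y s.1)))‖ := by
  rw [← integral_sub
    (integrableOn_mul_exp_neg_mul_Ici hlam0 (hGmeas _ hyc) fun t ht => hGbdd t ht _)
    (integrableOn_mul_exp_neg_mul_Ici hlam0 (hGmeas (fun t => A (yr t)) (by fun_prop))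
      fun t ht => hGbdd t ht _), ← integral_const_mul, ← Real.norm_eq_abs]
  refine norm_integral_le_of_norm_le ((integrableOn_mul_exp_mul_iSup_Icc
    (ρ := fun s => ‖F s (y s) - A (B (F s (y s)))‖) (M := M + M) (sub_neg.2 hlam)
    (fun _ => norm_nonneg _) fun s hs => ?_).const_mul Lg) ?_
  · have h1 := hbdd s hs (y s)
    exact (norm_sub_le _ _).trans (add_le_add h1 ((hA _).trans ((hB _).trans h1)))
  filter_upwards [ae_restrict_mem measurableSet_Ici] with t ht
  have ht : 0 ≤ t := ht
  rw [← sub_mul, norm_mul, Real.norm_eq_abs, Real.norm_eq_abs, abs_of_pos (exp_pos _)]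
  rcases subsingleton_or_nontrivial E with hE | hE
  · rw [Subsingleton.elim (y t) (A (yr t))]
    have : ∀ s : Icc (0 : ℝ) t, ‖F s.1 (y s.1) - A (B (F s.1 (y s.1)))‖ = 0 := fun s => by
      rw [Subsingleton.elim (F s.1 (y s.1) - A (B (F s.1 (y s.1)))) 0, norm_zero]
    simp [this]
  · obtain ⟨x, hx⟩ := exists_ne (0 : E)
    have hx' : 0 < ‖x - 0‖ := by simpa using hx
    have hL : 0 ≤ L :=
      nonneg_of_mul_nonneg_left ((norm_nonneg _).trans (hlip 0 le_rfl x 0)) hx'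
    have hLg : 0 ≤ Lg :=
      nonneg_of_mul_nonneg_left ((abs_nonneg _).trans (hGlip 0 le_rfl x 0)) hx'
    have h1 := norm_trajectory_sub_lift_le hA hB hL hmeas hbdd hlip hyc hy hyrc hyr ht
    have h2 := (hGlip t ht (y t) (A (yr t))).trans (mul_le_mul_of_nonneg_left h1 hLg)
    refine (mul_le_mul_of_nonneg_right h2 (exp_pos _).le).trans_eq ?_
    rw [show (L - lam) * t = L * t + -lam * t by ring, exp_add]
    ring

end Reduction

/-- Lemma 3.5: the difference between the value function of the full problem at `P^r y`
and the value function of the reduced problem at `P_c^r y` is bounded in terms of the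
projection errors of `f` along the optimal trajectories. -/
theorem value_function_full_vs_reduced {n m r : ℕ}
    (Uad : Set (EuclideanSpace ℝ (Fin m)))
    (hUad_comp : IsCompact Uad) (hUad_conv : Convex ℝ Uad)
    (φb : Fin r → EuclideanSpace ℝ (Fin n))
    (hφb : ∀ k l, ⟪φb k, φb l⟫ = if k = l then (1 : ℝ) else 0)
    (Pc : EuclideanSpace ℝ (Fin n) → EuclideanSpace ℝ (Fin r))
    (hPc : ∀ x k, Pc x k = ⟪x, φb k⟫)
    (lift : EuclideanSpace ℝ (Fin r) → EuclideanSpace ℝ (Fin n))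
    (hlift : ∀ c, lift c = ∑ k, c k • φb k)
    (P : EuclideanSpace ℝ (Fin n) → EuclideanSpace ℝ (Fin n))
    (hP : ∀ x, P x = ∑ k, ⟪x, φb k⟫ • φb k)
    (f : EuclideanSpace ℝ (Fin n) → EuclideanSpace ℝ (Fin m) → EuclideanSpace ℝ (Fin n))
    (g : EuclideanSpace ℝ (Fin n) → EuclideanSpace ℝ (Fin m) → ℝ)
    (Lf Mf Lg Mg lam : ℝ)
    (hf_cont : Continuous fun p : EuclideanSpace ℝ (Fin n) × EuclideanSpace ℝ (Fin m) => f p.1 p.2)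
    (hf_lip : ∀ y y' : EuclideanSpace ℝ (Fin n), ∀ u ∈ Uad, ‖f y u - f y' u‖ ≤ Lf * ‖y - y'‖)
    (hf_bdd : ∀ y : EuclideanSpace ℝ (Fin n), ∀ u ∈ Uad, ‖f y u‖ ≤ Mf)
    (hg_cont : Continuous fun p : EuclideanSpace ℝ (Fin n) × EuclideanSpace ℝ (Fin m) => g p.1 p.2)
    (hg_lip : ∀ y y' : EuclideanSpace ℝ (Fin n), ∀ u ∈ Uad, |g y u - g y' u| ≤ Lg * ‖y - y'‖)
    (hg_bdd : ∀ y : EuclideanSpace ℝ (Fin n), ∀ u ∈ Uad, |g y u| ≤ Mg)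
    (hlam : Lf < lam) (hlam0 : 0 < lam)
    (fr : EuclideanSpace ℝ (Fin r) → EuclideanSpace ℝ (Fin m) → EuclideanSpace ℝ (Fin r))
    (hfr : ∀ yr u, fr yr u = Pc (f (lift yr) u))
    (gr : EuclideanSpace ℝ (Fin r) → EuclideanSpace ℝ (Fin m) → ℝ)
    (hgr : ∀ yr u, gr yr u = g (lift yr) u)
    -- the value function of the full problem
    (v : EuclideanSpace ℝ (Fin n) → ℝ)
    (hv : ∀ z0 : EuclideanSpace ℝ (Fin n), v z0 = sInf {c : ℝ |
      ∃ (u : ℝ → EuclideanSpace ℝ (Fin m)) (y : ℝ → EuclideanSpace ℝ (Fin n)),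
        Measurable u ∧ (∀ t, 0 ≤ t → u t ∈ Uad) ∧ Continuous y ∧
        (∀ t, 0 ≤ t → y t = z0 + ∫ s in (0 : ℝ)..t, f (y s) (u s)) ∧
        c = ∫ t in Ici (0 : ℝ), g (y t) (u t) * exp (-lam * t)})
    -- the value function of the reduced problem
    (vr : EuclideanSpace ℝ (Fin r) → ℝ)
    (hvr : ∀ z0 : EuclideanSpace ℝ (Fin r), vr z0 = sInf {c : ℝ |
      ∃ (u : ℝ → EuclideanSpace ℝ (Fin m)) (yr : ℝ → EuclideanSpace ℝ (Fin r)),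
        Measurable u ∧ (∀ t, 0 ≤ t → u t ∈ Uad) ∧ Continuous yr ∧
        (∀ t, 0 ≤ t → yr t = z0 + ∫ s in (0 : ℝ)..t, fr (yr s) (u s)) ∧
        c = ∫ t in Ici (0 : ℝ), gr (yr t) (u t) * exp (-lam * t)})
    (y0 : EuclideanSpace ℝ (Fin n))
    -- `u` attains the infimum defining `v (P y0)`, with trajectory `ytraj`
    (u : ℝ → EuclideanSpace ℝ (Fin m)) (hu_meas : Measurable u)
    (hu_mem : ∀ t, 0 ≤ t → u t ∈ Uad)
    (ytraj : ℝ → EuclideanSpace ℝ (Fin n)) (hytraj_cont : Continuous ytraj)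
    (hytraj : ∀ t, 0 ≤ t → ytraj t = P y0 + ∫ s in (0 : ℝ)..t, f (ytraj s) (u s))
    (hu_opt : v (P y0) = ∫ t in Ici (0 : ℝ), g (ytraj t) (u t) * exp (-lam * t))
    -- `ur` attains the infimum defining `vr (Pc y0)`, with reduced trajectory `yrred`
    (ur : ℝ → EuclideanSpace ℝ (Fin m)) (hur_meas : Measurable ur)
    (hur_mem : ∀ t, 0 ≤ t → ur t ∈ Uad)
    (yrred : ℝ → EuclideanSpace ℝ (Fin r)) (hyrred_cont : Continuous yrred)
    (hyrred : ∀ t, 0 ≤ t → yrred t = Pc y0 + ∫ s in (0 : ℝ)..t, fr (yrred s) (ur s))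
    (hur_opt : vr (Pc y0) = ∫ t in Ici (0 : ℝ), gr (yrred t) (ur t) * exp (-lam * t))
    -- `yrfull` is the trajectory of the full system with initial state `P y0`
    -- and control `ur`
    (yrfull : ℝ → EuclideanSpace ℝ (Fin n)) (hyrfull_cont : Continuous yrfull)
    (hyrfull : ∀ t, 0 ≤ t → yrfull t = P y0 + ∫ s in (0 : ℝ)..t, f (yrfull s) (ur s)) :
    |v (P y0) - vr (Pc y0)| ≤
      (Lg * ∫ t in Ici (0 : ℝ), t * exp ((Lf - lam) * t) *
        ⨆ s : Icc (0 : ℝ) t, ‖f (ytraj s.1) (u s.1) - P (f (ytraj s.1) (u s.1))‖) +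
      Lg * ∫ t in Ici (0 : ℝ), t * exp ((Lf - lam) * t) *
        ⨆ s : Icc (0 : ℝ) t, ‖f (yrfull s.1) (ur s.1) - P (f (yrfull s.1) (ur s.1))‖ := by
  have hon : Orthonormal ℝ φb := orthonormal_iff_ite.2 hφb
  have hlift_norm : ∀ c, ‖lift c‖ = ‖c‖ := fun c => by
    rw [← sq_eq_sq₀ (norm_nonneg _) (norm_nonneg _), EuclideanSpace.norm_sq_eq c,
      ← real_inner_self_eq_norm_sq, hlift, hon.inner_sum]
    exact Finset.sum_congr rfl fun k _ => by simp [sq]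
  let A : EuclideanSpace ℝ (Fin r) →L[ℝ] EuclideanSpace ℝ (Fin n) :=
    LinearMap.toContinuousLinearMap
      { toFun := lift
        map_add' := fun c d => by
          simp only [hlift, PiLp.add_apply, add_smul, Finset.sum_add_distrib]
        map_smul' := fun a c => by
          simp only [hlift, PiLp.smul_apply, smul_eq_mul, mul_smul, Finset.smul_sum,
            RingHom.id_apply] }
  let B : EuclideanSpace ℝ (Fin n) →L[ℝ] EuclideanSpace ℝ (Fin r) :=
    LinearMap.toContinuousLinearMap
      { toFun := Pc
        map_add' := fun x x' => by
          ext k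
          simp only [hPc, PiLp.add_apply, inner_add_left]
        map_smul' := fun a x => by
          ext k
          simp only [hPc, PiLp.smul_apply, real_inner_smul_left, smul_eq_mul, RingHom.id_apply] }
  have hAl : ∀ c, A c = lift c := fun _ => rfl
  have hBP : ∀ x, B x = Pc x := fun _ => rfl
  have hA : ∀ c, ‖A c‖ ≤ ‖c‖ := fun c => (hlift_norm c).le
  have hB : ∀ x, ‖B x‖ ≤ ‖x‖ := fun x => by
    rw [← sq_le_sq₀ (norm_nonneg _) (norm_nonneg _), EuclideanSpace.norm_sq_eq]
    refine le_trans (le_of_eq ?_) (hon.sum_inner_products_le x (s := Finset.univ))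
    exact Finset.sum_congr rfl fun k _ => by rw [hBP, hPc, real_inner_comm]
  have hPAB : ∀ x, P x = A (B x) := fun x => by
    rw [hAl, hBP, hlift, hP]
    simp only [hPc]
  have hfmeas : ∀ {w : ℝ → EuclideanSpace ℝ (Fin m)}, Measurable w →
      ∀ x : ℝ → EuclideanSpace ℝ (Fin n), Continuous x →
        AEStronglyMeasurable (fun s => f (x s) (w s)) := fun hw x hx =>
    (hf_cont.measurable.comp (hx.measurable.prodMk hw)).aestronglyMeasurable
  have hgmeas : ∀ {w : ℝ → EuclideanSpace ℝ (Fin m)}, Measurable w →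
      ∀ x : ℝ → EuclideanSpace ℝ (Fin n), Continuous x →
        AEStronglyMeasurable (fun s => g (x s) (w s)) := fun hw x hx =>
    (hg_cont.measurable.comp (hx.measurable.prodMk hw)).aestronglyMeasurable
  have hcost : ∀ {w : ℝ → EuclideanSpace ℝ (Fin m)} {x : ℝ → EuclideanSpace ℝ (Fin n)}
      {x' : ℝ → EuclideanSpace ℝ (Fin r)}, Measurable w → (∀ t, 0 ≤ t → w t ∈ Uad) →
      Continuous x → (∀ t, 0 ≤ t → x t = P y0 + ∫ s in (0 : ℝ)..t, f (x s) (w s)) →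
      Continuous x' → (∀ t, 0 ≤ t → x' t = Pc y0 + ∫ s in (0 : ℝ)..t, fr (x' s) (w s)) →
      |(∫ t in Ici (0 : ℝ), g (x t) (w t) * exp (-lam * t)) -
          ∫ t in Ici (0 : ℝ), gr (x' t) (w t) * exp (-lam * t)| ≤
        Lg * ∫ t in Ici (0 : ℝ), t * exp ((Lf - lam) * t) *
          ⨆ s : Icc (0 : ℝ) t, ‖f (x s.1) (w s.1) - P (f (x s.1) (w s.1))‖ := by
    intro w x x' hw hwU hx hxeq hx' hxeq'
    simp only [hgr, hPAB, ← hAl]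
    refine abs_cost_sub_reduced_cost_le (F := fun s x => f x (w s)) (G := fun s x => g x (w s))
      (z := Pc y0) hA hB (hfmeas hw) (fun s hs x => hf_bdd x _ (hwU s hs))
      (fun s hs x x' => hf_lip x x' _ (hwU s hs)) (hgmeas hw)
      (fun s hs x => hg_bdd x _ (hwU s hs)) (fun s hs x x' => hg_lip x x' _ (hwU s hs))
      hlam hlam0 hx (fun t ht => ?_) hx' fun t ht => ?_
    · rw [hxeq t ht, hPAB, hBP]
    · rw [hxeq' t ht]
      simp only [hfr, hAl, hBP]
  obtain ⟨yr, hyrc, hyr⟩ := exists_continuous_integral_solution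
    (F := fun s x => fr x (u s)) (L := |Lf|) (M := Mf) (abs_nonneg _)
    (fun w hw => by
      simp only [hfr, ← hBP, ← hAl]
      exact B.continuous.comp_aestronglyMeasurable
        (hfmeas hu_meas (fun s => A (w s)) (A.continuous.comp hw)))
    (fun s hs x => by
      rw [hfr, ← hBP]
      exact (hB _).trans (hf_bdd _ _ (hu_mem s hs)))
    (fun s hs x x' => by
      rw [hfr, hfr, ← hBP, ← hBP, ← map_sub]
      refine (hB _).trans ((hf_lip _ _ _ (hu_mem s hs)).trans ?_)
      rw [← hAl, ← hAl, ← map_sub]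
      exact mul_le_mul (le_abs_self _) (hA _) (norm_nonneg _) (abs_nonneg _))
    (Pc y0)
  have hv_le : v (P y0) ≤ ∫ t in Ici (0 : ℝ), g (yrfull t) (ur t) * exp (-lam * t) := by
    rw [hv]
    refine csInf_le ⟨-∫ t in Ici (0 : ℝ), Mg * exp (-lam * t), ?_⟩
      ⟨ur, yrfull, hur_meas, hur_mem, hyrfull_cont, hyrfull, rfl⟩
    rintro _ ⟨w, x, -, hwU, -, -, rfl⟩
    exact neg_le_of_abs_le
      (abs_setIntegral_mul_exp_le hlam0 fun t ht => hg_bdd _ _ (hwU t ht))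
  have hvr_le : vr (Pc y0) ≤ ∫ t in Ici (0 : ℝ), gr (yr t) (u t) * exp (-lam * t) := by
    rw [hvr]
    refine csInf_le ⟨-∫ t in Ici (0 : ℝ), Mg * exp (-lam * t), ?_⟩
      ⟨u, yr, hu_meas, hu_mem, hyrc, hyr, rfl⟩
    rintro _ ⟨w, x, -, hwU, -, -, rfl⟩
    refine neg_le_of_abs_le (abs_setIntegral_mul_exp_le hlam0 fun t ht => ?_)
    rw [hgr]
    exact hg_bdd _ _ (hwU t ht)
  have h1 := hcost hu_meas hu_mem hytraj_cont hytraj hyrc hyr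
  have h2 := hcost hur_meas hur_mem hyrfull_cont hyrfull hyrred_cont hyrred
  have h1' := (abs_nonneg _).trans h1
  have h2' := (abs_nonneg _).trans h2
  rw [← hu_opt] at h1
  rw [← hur_opt] at h2
  rw [abs_le] at h1 h2 ⊢
  constructor <;> linarith [h1.1, h1.2, h2.1, h2.2]
end

section
/- Assume λ > L_f and that for every initial state and admissible control a trajectory exists. For any admissible control u and any y₀, ỹ₀ ∈ ℝⁿ, let y and ỹ be trajectories with control u and initial states y₀ and ỹ₀ respectively. Then | ∫₀^∞ g(y(t),u(t)) e^{−λt} dt − ∫₀^∞ g(ỹ(t),u(t)) e^{−λt} dt | ≤ (L_g/(λ − L_f)) ‖y₀ − ỹ₀‖. -/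
open MeasureTheory Real Set

/-- Integral form of Grönwall's inequality with a constant kernel. -/
theorem le_mul_exp_of_le_add_mul_integral_s11 {φ : ℝ → ℝ} {δ K : ℝ} (hφ : Continuous φ)
    (hφ_nonneg : ∀ t, 0 ≤ φ t) (hδ : 0 ≤ δ) (hK : 0 ≤ K)
    (h : ∀ t, 0 ≤ t → φ t ≤ δ + K * ∫ s in (0 : ℝ)..t, φ s) {t : ℝ} (ht : 0 ≤ t) :
    φ t ≤ δ * exp (K * t) := by
  have hderiv : ∀ x, HasDerivAt (fun t => δ + K * ∫ s in (0 : ℝ)..t, φ s) (K * φ x) x := fun x =>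
    ((intervalIntegral.integral_hasDerivAt_right (hφ.intervalIntegrable _ _)
      (hφ.stronglyMeasurableAtFilter _ _) hφ.continuousAt).const_mul K).const_add δ
  have key := norm_le_gronwallBound_of_norm_deriv_right_le (a := 0) (b := t) (δ := δ) (K := K)
    (ε := 0) (fun x _ => (hderiv x).continuousAt.continuousWithinAt)
    (fun x _ => (hderiv x).hasDerivWithinAt) (by simp [abs_of_nonneg hδ])
    (fun x hx => by
      rw [norm_of_nonneg (mul_nonneg hK (hφ_nonneg x)), add_zero]
      exact mul_le_mul_of_nonneg_left ((h x hx.1).trans (le_abs_self _)) hK)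
    t ⟨ht, le_rfl⟩
  rw [gronwallBound_ε0, sub_zero] at key
  exact (h t ht).trans ((le_abs_self _).trans key)

/-- A continuous function is interval integrable along a continuous path paired with a measurable
control taking values in a compact set. -/
theorem intervalIntegrable_comp_of_mem_isCompact {E F G : Type*}
    [NormedAddCommGroup E] [MeasurableSpace E] [BorelSpace E] [SecondCountableTopology E]
    [NormedAddCommGroup F] [MeasurableSpace F] [BorelSpace F] [SecondCountableTopology F]
    [NormedAddCommGroup G] [MeasurableSpace G] [BorelSpace G] [SecondCountableTopology G]
    {f : E → F → G} (hf : Continuous fun p : E × F => f p.1 p.2) {U : Set F} (hU : IsCompact U)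
    {y : ℝ → E} (hy : Continuous y) {u : ℝ → F} (hu : Measurable u)
    (hu_mem : ∀ t, 0 ≤ t → u t ∈ U) {t : ℝ} (ht : 0 ≤ t) :
    IntervalIntegrable (fun s => f (y s) (u s)) volume 0 t := by
  obtain ⟨C, hC⟩ := (((isCompact_Icc (a := (0 : ℝ)) (b := t)).image hy).prod
    hU).exists_bound_of_continuousOn hf.continuousOn
  rw [intervalIntegrable_iff_integrableOn_Ioc_of_le ht]
  refine Measure.integrableOn_of_bounded (M := C) measure_Ioc_lt_top.ne
    (hf.measurable.comp (hy.measurable.prodMk hu)).aestronglyMeasurable ?_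
  refine (ae_restrict_iff' measurableSet_Ioc).2 (ae_of_all _ fun s hs => ?_)
  exact hC (y s, u s) ⟨mem_image_of_mem y ⟨hs.1.le, hs.2⟩, hu_mem s hs.1.le⟩

/-- A bounded measurable function is integrable on the half line against a decaying exponential. -/
theorem integrableOn_mul_exp_of_bounded {h : ℝ → ℝ} {M r : ℝ} (hr : 0 < r) (hh : Measurable h)
    (hM : ∀ t, 0 ≤ t → |h t| ≤ M) :
    IntegrableOn (fun t => h t * exp (-r * t)) (Ici 0) := by
  have hexp : IntegrableOn (fun t => exp (-r * t)) (Ici 0) :=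
    (integrableOn_Ici_iff_integrableOn_Ioi).2 (integrableOn_exp_mul_Ioi (neg_lt_zero.2 hr) 0)
  exact Integrable.bdd_mul hexp hh.aestronglyMeasurable
    ((ae_restrict_iff' measurableSet_Ici).2 (ae_of_all _ hM))

/-- Lipschitz dependence of the discounted cost on the initial state: for a fixed
admissible control, trajectories from two initial states have discounted costs that
differ by at most `L_g/(λ - L_f)` times the distance of the initial states. -/
theorem cost_lipschitz_in_initial_state {n m : ℕ}
    (Uad : Set (EuclideanSpace ℝ (Fin m)))
    (hUad_comp : IsCompact Uad) (hUad_conv : Convex ℝ Uad)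
    (f : EuclideanSpace ℝ (Fin n) → EuclideanSpace ℝ (Fin m) → EuclideanSpace ℝ (Fin n))
    (g : EuclideanSpace ℝ (Fin n) → EuclideanSpace ℝ (Fin m) → ℝ)
    (Lf Lg Mg lam : ℝ)
    (hf_cont : Continuous fun p : EuclideanSpace ℝ (Fin n) × EuclideanSpace ℝ (Fin m) => f p.1 p.2)
    (hf_lip : ∀ y y' : EuclideanSpace ℝ (Fin n), ∀ u ∈ Uad, ‖f y u - f y' u‖ ≤ Lf * ‖y - y'‖)
    (hg_cont : Continuous fun p : EuclideanSpace ℝ (Fin n) × EuclideanSpace ℝ (Fin m) => g p.1 p.2)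
    (hg_lip : ∀ y y' : EuclideanSpace ℝ (Fin n), ∀ u ∈ Uad, |g y u - g y' u| ≤ Lg * ‖y - y'‖)
    (hg_bdd : ∀ y : EuclideanSpace ℝ (Fin n), ∀ u ∈ Uad, |g y u| ≤ Mg)
    (hlam : Lf < lam) (hlam0 : 0 < lam)
    -- existence of trajectories for every initial state and admissible control
    (hexist : ∀ (y0 : EuclideanSpace ℝ (Fin n)) (u : ℝ → EuclideanSpace ℝ (Fin m)),
      Measurable u → (∀ t, 0 ≤ t → u t ∈ Uad) →
      ∃ y : ℝ → EuclideanSpace ℝ (Fin n), Continuous y ∧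
        ∀ t, 0 ≤ t → y t = y0 + ∫ s in (0 : ℝ)..t, f (y s) (u s))
    (u : ℝ → EuclideanSpace ℝ (Fin m)) (hu_meas : Measurable u)
    (hu_mem : ∀ t, 0 ≤ t → u t ∈ Uad)
    (y0 ytil0 : EuclideanSpace ℝ (Fin n))
    (y ytil : ℝ → EuclideanSpace ℝ (Fin n))
    (hy_cont : Continuous y) (hytil_cont : Continuous ytil)
    (hy_traj : ∀ t, 0 ≤ t → y t = y0 + ∫ s in (0 : ℝ)..t, f (y s) (u s))
    (hytil_traj : ∀ t, 0 ≤ t → ytil t = ytil0 + ∫ s in (0 : ℝ)..t, f (ytil s) (u s)) :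
    |(∫ t in Ici (0 : ℝ), g (y t) (u t) * exp (-lam * t)) -
        ∫ t in Ici (0 : ℝ), g (ytil t) (u t) * exp (-lam * t)| ≤
      (Lg / (lam - Lf)) * ‖y0 - ytil0‖ := by
  rcases subsingleton_or_nontrivial (EuclideanSpace ℝ (Fin n)) with hsub | hnt
  · rw [Subsingleton.elim ytil y, Subsingleton.elim ytil0 y0]
    simp
  obtain ⟨a, b, hab⟩ := exists_pair_ne (EuclideanSpace ℝ (Fin n))
  have hpos : 0 < ‖a - b‖ := norm_pos_iff.2 (sub_ne_zero.2 hab)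
  have hLf : 0 ≤ Lf := nonneg_of_mul_nonneg_left
    ((norm_nonneg _).trans (hf_lip a b _ (hu_mem 0 le_rfl))) hpos
  have hLg : 0 ≤ Lg := nonneg_of_mul_nonneg_left
    ((abs_nonneg _).trans (hg_lip a b _ (hu_mem 0 le_rfl))) hpos
  have hdiff : Continuous fun t => ‖y t - ytil t‖ := (hy_cont.sub hytil_cont).norm
  have hgrow : ∀ t, 0 ≤ t → ‖y t - ytil t‖ ≤ ‖y0 - ytil0‖ * exp (Lf * t) := by
    intro t ht
    refine le_mul_exp_of_le_add_mul_integral_s11 hdiff (fun _ => norm_nonneg _) (norm_nonneg _) hLf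
      (fun t ht => ?_) ht
    rw [hy_traj t ht, hytil_traj t ht, add_sub_add_comm, ← intervalIntegral.integral_sub
      (intervalIntegrable_comp_of_mem_isCompact hf_cont hUad_comp hy_cont hu_meas hu_mem ht)
      (intervalIntegrable_comp_of_mem_isCompact hf_cont hUad_comp hytil_cont hu_meas hu_mem ht),
      ← intervalIntegral.integral_const_mul]
    refine (norm_add_le _ _).trans (add_le_add le_rfl ?_)
    exact intervalIntegral.norm_integral_le_of_norm_le ht
      (ae_of_all _ fun s hs => hf_lip _ _ _ (hu_mem s hs.1.le))
      ((hdiff.const_mul Lf).intervalIntegrable _ _)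
  have hint : ∀ z : ℝ → EuclideanSpace ℝ (Fin n), Continuous z →
      IntegrableOn (fun t => g (z t) (u t) * exp (-lam * t)) (Ici 0) := fun z hz =>
    integrableOn_mul_exp_of_bounded hlam0 (hg_cont.measurable.comp (hz.measurable.prodMk hu_meas))
      fun t ht => hg_bdd _ _ (hu_mem t ht)
  have hneg : Lf - lam < 0 := sub_neg.2 hlam
  have hbound : IntegrableOn (fun t => Lg * ‖y0 - ytil0‖ * exp ((Lf - lam) * t)) (Ici 0) :=
    ((integrableOn_Ici_iff_integrableOn_Ioi).2 (integrableOn_exp_mul_Ioi hneg 0)).const_mul _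
  rw [← integral_sub (hint y hy_cont) (hint ytil hytil_cont), ← Real.norm_eq_abs]
  calc ‖∫ t in Ici (0 : ℝ), (g (y t) (u t) * exp (-lam * t) - g (ytil t) (u t) * exp (-lam * t))‖
      ≤ ∫ t in Ici (0 : ℝ), Lg * ‖y0 - ytil0‖ * exp ((Lf - lam) * t) := by
        refine norm_integral_le_of_norm_le hbound
          ((ae_restrict_iff' measurableSet_Ici).2 (ae_of_all _ fun t ht => ?_))
        rw [← sub_mul, norm_mul, Real.norm_eq_abs, norm_of_nonneg (exp_pos _).le]
        calc |g (y t) (u t) - g (ytil t) (u t)| * exp (-lam * t)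
            ≤ Lg * (‖y0 - ytil0‖ * exp (Lf * t)) * exp (-lam * t) := by
              gcongr
              exact (hg_lip _ _ _ (hu_mem t ht)).trans
                (mul_le_mul_of_nonneg_left (hgrow t ht) hLg)
          _ = Lg * ‖y0 - ytil0‖ * exp ((Lf - lam) * t) := by
              rw [sub_eq_add_neg Lf, add_mul, exp_add]
              ring
    _ = Lg / (lam - Lf) * ‖y0 - ytil0‖ := by
        rw [integral_const_mul, integral_Ici_eq_integral_Ioi, integral_exp_mul_Ioi hneg 0,
          mul_zero, exp_zero]
        have h1 : lam - Lf ≠ 0 := (sub_pos.2 hlam).ne'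
        have h2 : Lf - lam ≠ 0 := hneg.ne
        field_simp
        ring
end

section
/- For every λ > 0 and every h ∈ (0, 1/λ) there exists a unique bounded continuous function v_h : ℝⁿ → ℝ satisfying v_h(y) = inf_{u ∈ U_ad} { (1 − λh) v_h(y + h f(y,u)) + h g(y,u) } for all y ∈ ℝⁿ; moreover, for each y the infimum over the compact set U_ad is attained. -/
open Real Set

open scoped BoundedContinuousFunction

/-- Infima over a nonempty compact set are nonexpansive for the uniform distance. -/
theorem IsCompact.abs_sInf_image_sub_sInf_image_le {U : Type*} [TopologicalSpace U] {K : Set U}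
    (hK : IsCompact K) (hne : K.Nonempty) {a b : U → ℝ} (ha : Continuous a) (hb : Continuous b)
    {C : ℝ} (hab : ∀ u ∈ K, |a u - b u| ≤ C) : |sInf (a '' K) - sInf (b '' K)| ≤ C := by
  have hA := (hK.image ha).isLeast_sInf (hne.image a)
  have hB := (hK.image hb).isLeast_sInf (hne.image b)
  obtain ⟨p, hp, hpa⟩ := hA.1
  obtain ⟨q, hq, hqb⟩ := hB.1
  have h₁ := hA.2 (mem_image_of_mem a hq)
  have h₂ := hB.2 (mem_image_of_mem b hp)
  have h₃ := abs_le.1 (hab p hp)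
  have h₄ := abs_le.1 (hab q hq)
  rw [abs_le]
  constructor <;> linarith [h₃.1, h₄.2]

section Bellman

variable {X U : Type*} [TopologicalSpace X] [TopologicalSpace U]

/-- The discounted dynamic programming operator with controls in a compact set `K`, dynamics `Φ`,
running cost `ℓ` bounded by `M` on `K`, and discount factor `β`. -/
noncomputable def bellmanOperator {K : Set U} (hK : IsCompact K) (hne : K.Nonempty)
    {Φ : X → U → X} {ℓ : X → U → ℝ} (hΦ : Continuous fun p : X × U => Φ p.1 p.2)
    (hℓ : Continuous fun p : X × U => ℓ p.1 p.2) {M : ℝ} (hM : ∀ x, ∀ u ∈ K, |ℓ x u| ≤ M)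
    {β : ℝ} (hβ : 0 ≤ β) (v : X →ᵇ ℝ) : X →ᵇ ℝ :=
  BoundedContinuousFunction.ofNormedAddCommGroup
    (fun x => sInf ((fun u => β * v (Φ x u) + ℓ x u) '' K))
    (hK.continuous_sInf (f := fun x u => β * v (Φ x u) + ℓ x u)
      ((continuous_const.mul (v.continuous.comp hΦ)).add hℓ))
    (β * ‖v‖ + M) (by
      intro x
      have hc : Continuous fun u => β * v (Φ x u) + ℓ x u :=
        ((continuous_const.mul (v.continuous.comp hΦ)).add hℓ).comp (Continuous.prodMk_right x)
      obtain ⟨u, hu, h⟩ := ((hK.image hc).isLeast_sInf (hne.image _)).1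
      rw [← h]
      refine (norm_add_le _ _).trans (add_le_add ?_ (hM x u hu))
      rw [norm_mul, Real.norm_of_nonneg hβ]
      exact mul_le_mul_of_nonneg_left (v.norm_coe_le_norm _) hβ)

theorem contractingWith_bellmanOperator {K : Set U} (hK : IsCompact K) (hne : K.Nonempty)
    {Φ : X → U → X} {ℓ : X → U → ℝ} (hΦ : Continuous fun p : X × U => Φ p.1 p.2)
    (hℓ : Continuous fun p : X × U => ℓ p.1 p.2) {M : ℝ} (hM : ∀ x, ∀ u ∈ K, |ℓ x u| ≤ M)
    {β : ℝ} (hβ : 0 ≤ β) (hβ1 : β < 1) :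
    ContractingWith ⟨β, hβ⟩ (bellmanOperator hK hne hΦ hℓ hM hβ) := by
  refine ⟨by exact_mod_cast hβ1, LipschitzWith.of_dist_le_mul fun v w => ?_⟩
  have hc : ∀ (v : X →ᵇ ℝ) (x : X), Continuous fun u => β * v (Φ x u) + ℓ x u := fun v x =>
    ((continuous_const.mul (v.continuous.comp hΦ)).add hℓ).comp (Continuous.prodMk_right x)
  refine (BoundedContinuousFunction.dist_le (mul_nonneg hβ dist_nonneg)).2 fun x => ?_
  refine hK.abs_sInf_image_sub_sInf_image_le hne (hc v x) (hc w x) fun u _ => ?_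
  rw [add_sub_add_right_eq_sub, ← mul_sub, abs_mul, abs_of_nonneg hβ, ← Real.dist_eq]
  exact mul_le_mul_of_nonneg_left (BoundedContinuousFunction.dist_coe_le_dist _) hβ

end Bellman

/-- Existence and uniqueness for the semidiscrete dynamic programming equation: for
every `λ > 0` and `h ∈ (0, 1/λ)` there is a unique bounded continuous `v_h` with
`v_h(y) = inf_{u ∈ U_ad} {(1 - λh) v_h(y + h f(y,u)) + h g(y,u)}` for all `y`, and
for each `y` the infimum over the compact set `U_ad` is attained (so `v_h y` is in
fact the least element of the set). -/
theorem semidiscrete_dpp_exists_unique {n m : ℕ}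
    (Uad : Set (EuclideanSpace ℝ (Fin m)))
    (hUad_comp : IsCompact Uad) (hUad_conv : Convex ℝ Uad) (hUad_ne : Uad.Nonempty)
    (f : EuclideanSpace ℝ (Fin n) → EuclideanSpace ℝ (Fin m) → EuclideanSpace ℝ (Fin n))
    (g : EuclideanSpace ℝ (Fin n) → EuclideanSpace ℝ (Fin m) → ℝ)
    (Lf Lg Mg : ℝ)
    (hf_cont : Continuous fun p : EuclideanSpace ℝ (Fin n) × EuclideanSpace ℝ (Fin m) => f p.1 p.2)
    (hf_lip : ∀ y y' : EuclideanSpace ℝ (Fin n), ∀ u ∈ Uad, ‖f y u - f y' u‖ ≤ Lf * ‖y - y'‖)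
    (hf_lip_u : ∀ y : EuclideanSpace ℝ (Fin n), ∀ u u' : EuclideanSpace ℝ (Fin m),
      u ∈ Uad → u' ∈ Uad → ‖f y u - f y u'‖ ≤ Lf * ‖u - u'‖)
    (hg_cont : Continuous fun p : EuclideanSpace ℝ (Fin n) × EuclideanSpace ℝ (Fin m) => g p.1 p.2)
    (hg_lip : ∀ y y' : EuclideanSpace ℝ (Fin n), ∀ u ∈ Uad, |g y u - g y' u| ≤ Lg * ‖y - y'‖)
    (hg_lip_u : ∀ y : EuclideanSpace ℝ (Fin n), ∀ u u' : EuclideanSpace ℝ (Fin m),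
      u ∈ Uad → u' ∈ Uad → |g y u - g y u'| ≤ Lg * ‖u - u'‖)
    (hg_bdd : ∀ y : EuclideanSpace ℝ (Fin n), ∀ u ∈ Uad, |g y u| ≤ Mg) :
    ∀ lam : ℝ, 0 < lam → ∀ h ∈ Ioo (0 : ℝ) (1 / lam),
      ∃ vh : EuclideanSpace ℝ (Fin n) → ℝ,
        (Continuous vh ∧ (∃ B, ∀ y, |vh y| ≤ B) ∧
          ∀ y : EuclideanSpace ℝ (Fin n),
            IsLeast {c : ℝ | ∃ u ∈ Uad,
              c = (1 - lam * h) * vh (y + h • f y u) + h * g y u} (vh y)) ∧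
        ∀ vh' : EuclideanSpace ℝ (Fin n) → ℝ,
          Continuous vh' → (∃ B, ∀ y, |vh' y| ≤ B) →
          (∀ y : EuclideanSpace ℝ (Fin n),
            vh' y = sInf {c : ℝ | ∃ u ∈ Uad,
              c = (1 - lam * h) * vh' (y + h • f y u) + h * g y u}) →
          vh' = vh := by
  rintro lam hlam h ⟨h0, h1⟩
  have hlh : lam * h < 1 := by rwa [lt_div_iff₀ hlam, mul_comm] at h1
  have hβ : 0 ≤ 1 - lam * h := by linarith
  have hβ1 : 1 - lam * h < 1 := by linarith [mul_pos hlam h0]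
  have hΦ : Continuous fun p : EuclideanSpace ℝ (Fin n) × EuclideanSpace ℝ (Fin m) =>
      p.1 + h • f p.1 p.2 := continuous_fst.add (hf_cont.const_smul h)
  have hℓ : Continuous fun p : EuclideanSpace ℝ (Fin n) × EuclideanSpace ℝ (Fin m) =>
      h * g p.1 p.2 := continuous_const.mul hg_cont
  have hM : ∀ y, ∀ u ∈ Uad, |h * g y u| ≤ h * Mg := fun y u hu => by
    rw [abs_mul, abs_of_pos h0]
    exact mul_le_mul_of_nonneg_left (hg_bdd y u hu) h0.le
  have hset : ∀ (v : EuclideanSpace ℝ (Fin n) → ℝ) (y : EuclideanSpace ℝ (Fin n)),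
      {c : ℝ | ∃ u ∈ Uad, c = (1 - lam * h) * v (y + h • f y u) + h * g y u} =
        (fun u => (1 - lam * h) * v (y + h • f y u) + h * g y u) '' Uad := fun v y => by
    ext c
    simp only [mem_ofPred_eq, mem_image, eq_comm]
  have hT := contractingWith_bellmanOperator hUad_comp hUad_ne
    (Φ := fun y u => y + h • f y u) (ℓ := fun y u => h * g y u) hΦ hℓ hM hβ hβ1
  set T := bellmanOperator hUad_comp hUad_ne
    (Φ := fun y u => y + h • f y u) (ℓ := fun y u => h * g y u) hΦ hℓ hM hβ
  obtain ⟨v, hv⟩ : ∃ v, Function.IsFixedPt T v :=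
    ⟨ContractingWith.fixedPoint T hT, hT.fixedPoint_isFixedPt⟩
  refine ⟨v, ⟨v.continuous, ⟨‖v‖, v.norm_coe_le_norm⟩, fun y => ?_⟩, ?_⟩
  · have hc : Continuous fun u => (1 - lam * h) * v (y + h • f y u) + h * g y u :=
      ((continuous_const.mul (v.continuous.comp hΦ)).add hℓ).comp (Continuous.prodMk_right y)
    have hvy : sInf ((fun u => (1 - lam * h) * v (y + h • f y u) + h * g y u) '' Uad) = v y :=
      DFunLike.congr_fun hv y
    rw [hset, ← hvy]
    simpa only [hvy] using (hUad_comp.image hc).isLeast_sInf (hUad_ne.image _)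
  · rintro w hw ⟨B, hB⟩ hweq
    let w' : EuclideanSpace ℝ (Fin n) →ᵇ ℝ :=
      BoundedContinuousFunction.ofNormedAddCommGroup w hw B hB
    have hw' : Function.IsFixedPt T w' :=
      BoundedContinuousFunction.ext fun y => ((hweq y).trans (by rw [hset]; rfl)).symm
    exact congrArg DFunLike.coe (hT.fixedPoint_unique' hw' hv)
end
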